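/- arXiv:1809.09226 — 2 statements merged into one kernel-verified Lean document; each statement's English description precedes it below -/
import Mathlib

section
/- Let V be a faithful irreducible four-dimensional complex representation of the quasi-simple group 2.A7. Then there are no nonzero 2.A7-invariant homogeneous polynomial functions on V of any degree at most 7, and the space of invariant homogeneous polynomials of degree 8 is one-dimensional. In particular, the induced action of A7 on ℙ³ = ℙ(V) leaves invariant no surface of degree less than 8. -/
/-- `G` is isomorphic to `2.A₇`: a perfect group whose center is cyclic of order `2` and whose
quotient by the center is the alternating group `A₇`.  Unique up to isomorphism. -/
def IsDoubleCoverA7 (G : Type*) [Group G] : Prop :=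
  commutator G = ⊤ ∧ IsCyclic (Subgroup.center G) ∧ Nat.card (Subgroup.center G) = 2 ∧
    Nonempty (G ⧸ Subgroup.center G ≃* alternatingGroup (Fin 7))

/-- The space of homogeneous polynomial functions of degree `d` on `V`: the span, inside the
space of all functions `V → ℂ`, of products of `d` linear functionals. -/
noncomputable def homPoly (V : Type*) [AddCommGroup V] [Module ℂ V] (d : ℕ) :
    Submodule ℂ (V → ℂ) :=
  Submodule.span ℂ {f | ∃ φ : Fin d → Module.Dual ℂ V, f = fun v => ∏ i, φ i v}

section PolyTrace
set_option linter.unusedSectionVars false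
variable {V : Type} [AddCommGroup V] [Module ℂ V] [FiniteDimensional ℂ V]

lemma exists_eigenbasis (hdim : Module.finrank ℂ V = 4) (T : Module.End ℂ V) (n : ℕ) (hn : n ≠ 0)
    (hT : T ^ n = 1) : ∃ (b : Module.Basis (Fin 4) ℂ V) (l : Fin 4 → ℂ), ∀ i, T (b i) = l i • b i := by
  classical
  have hss : T.IsSemisimple := by
    apply Module.End.isSemisimple_of_squarefree_aeval_eq_zero (p := (Polynomial.X ^ n - 1 : Polynomial ℂ))
    · apply Polynomial.Separable.squarefree
      exact (Polynomial.X_pow_sub_one_separable_iff).2 (by exact_mod_cast hn)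
    · simp [hT]
  have htop := hss.iSup_eigenspace_eq_top
  have hind := Module.End.eigenspaces_iSupIndep T
  have hint : DirectSum.IsInternal (fun μ : ℂ => T.eigenspace μ) :=
    (DirectSum.isInternal_submodule_iff_iSupIndep_and_iSup_eq_top _).2 ⟨hind, htop⟩
  let b := hint.collectedBasis (fun μ => Module.finBasis ℂ (T.eigenspace μ))
  have hfin := Module.Finite.finite_basis b
  have := Fintype.ofFinite (Σ μ, Fin (Module.finrank ℂ (T.eigenspace μ)))
  have hc : Fintype.card (Σ μ, Fin (Module.finrank ℂ (T.eigenspace μ))) = Fintype.card (Fin 4) := by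
    rw [← Module.finrank_eq_card_basis b, hdim]; simp
  let e := Fintype.equivOfCardEq hc
  refine ⟨b.reindex e, fun i => (e.symm i).1, fun i => ?_⟩
  rw [Module.Basis.reindex_apply]
  exact Module.End.mem_eigenspace_iff.1 (hint.collectedBasis_mem _ _)

/-- evaluation of polynomials in the coordinates of a basis -/
noncomputable def coordEval (b : Module.Basis (Fin 4) ℂ V) : MvPolynomial (Fin 4) ℂ →ₐ[ℂ] (V → ℂ) :=
  MvPolynomial.aeval (fun i v => b.coord i v)

lemma coordEval_apply (b : Module.Basis (Fin 4) ℂ V) (p : MvPolynomial (Fin 4) ℂ) (v : V) :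
    coordEval b p v = MvPolynomial.eval (fun i => b.coord i v) p := by
  induction p using MvPolynomial.induction_on with
  | C a => simp [coordEval]
  | add p q hp hq => simp [hp, hq]
  | mul_X p i hp => simp [hp]; simp [coordEval]

lemma coordEval_inj (b : Module.Basis (Fin 4) ℂ V) : Function.Injective (coordEval b) := by
  intro p q h
  apply MvPolynomial.funext
  intro x
  have := congrFun h (b.equivFun.symm x)
  rw [coordEval_apply, coordEval_apply] at this
  have h2 : (fun i => b.coord i (b.equivFun.symm x)) = x := by
    ext i
    have := congrFun (b.equivFun.apply_symm_apply x) i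
    simpa using this
  rwa [h2] at this

lemma homPoly_eq_span (b : Module.Basis (Fin 4) ℂ V) (d : ℕ) :
    homPoly V d = Submodule.span ℂ (Set.range
      (fun a : (Finset.finsuppAntidiag (Finset.univ : Finset (Fin 4)) d) =>
        coordEval b (MvPolynomial.monomial a.1 1))) := by
  apply le_antisymm
  · rw [homPoly, Submodule.span_le]
    rintro f ⟨φ, rfl⟩
    have h1 : (fun v => ∏ i, φ i v) =
        coordEval b (∏ i, ∑ j, MvPolynomial.C (φ i (b j)) * MvPolynomial.X j) := by
      ext v
      rw [coordEval_apply]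
      simp only [map_prod, map_sum, map_mul, MvPolynomial.eval_C, MvPolynomial.eval_X]
      refine Finset.prod_congr rfl fun i _ => ?_
      conv_lhs => rw [← b.sum_repr v, map_sum]
      refine Finset.sum_congr rfl fun j _ => ?_
      rw [map_smul, smul_eq_mul, mul_comm, Module.Basis.coord_apply]
    have h2 : (∏ i, ∑ j, MvPolynomial.C (φ i (b j)) * MvPolynomial.X j).IsHomogeneous d := by
      have := MvPolynomial.IsHomogeneous.prod (Finset.univ : Finset (Fin d))
        (fun i => ∑ j, MvPolynomial.C (φ i (b j)) * MvPolynomial.X j) (fun _ => 1)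
        (fun i _ => MvPolynomial.IsHomogeneous.sum _ _ _ fun j _ => by
          simpa using (MvPolynomial.isHomogeneous_C (Fin 4) (φ i (b j))).mul (MvPolynomial.isHomogeneous_X ℂ j))
      simpa using this
    rw [h1]
    generalize (∏ i, ∑ j, MvPolynomial.C (φ i (b j)) * MvPolynomial.X j) = p at h2
    rw [SetLike.mem_coe, p.as_sum, map_sum]
    refine Submodule.sum_mem _ fun a ha => ?_
    have h3 : MvPolynomial.monomial a (p.coeff a) = p.coeff a • MvPolynomial.monomial a (1:ℂ) := by
      rw [MvPolynomial.smul_monomial]; simp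
    rw [h3, map_smul]
    refine Submodule.smul_mem _ _ (Submodule.subset_span ⟨⟨a, ?_⟩, rfl⟩)
    have h4 := h2 (MvPolynomial.mem_support_iff.1 ha)
    rw [Finset.mem_finsuppAntidiag]
    refine ⟨?_, Finset.subset_univ _⟩
    rw [← h4, Finsupp.weight_apply, Finsupp.sum_fintype _ _ (by simp)]
    simp
  · rw [Submodule.span_le]
    rintro f ⟨⟨a, ha⟩, rfl⟩
    rw [Finset.mem_finsuppAntidiag] at ha
    have hs : Fintype.card (Σ i : Fin 4, Fin (a i)) = Fintype.card (Fin d) := by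
      simp [ha.1]
    let e := Fintype.equivOfCardEq hs
    apply Submodule.subset_span
    refine ⟨fun k => b.coord (e.symm k).1, ?_⟩
    ext v
    change coordEval b (MvPolynomial.monomial a 1) v = _
    rw [coordEval_apply, MvPolynomial.eval_monomial, Finsupp.prod_fintype _ _ (by simp)]
    rw [← Equiv.prod_comp e]
    simp only [Equiv.symm_apply_apply]
    rw [Fintype.prod_sigma]
    simp

lemma homBasis_indep (b : Module.Basis (Fin 4) ℂ V) (d : ℕ) : LinearIndependent ℂ
    (fun a : (Finset.finsuppAntidiag (Finset.univ : Finset (Fin 4)) d) =>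
        coordEval b (MvPolynomial.monomial a.1 1)) := by
  have h := (MvPolynomial.basisMonomials (Fin 4) ℂ).linearIndependent
  have h2 := (h.map' (coordEval b).toLinearMap
    (LinearMap.ker_eq_bot.2 (coordEval_inj b))).comp
    (fun a : (Finset.finsuppAntidiag (Finset.univ : Finset (Fin 4)) d) => a.1)
    Subtype.val_injective
  rw [MvPolynomial.coe_basisMonomials] at h2
  exact h2

noncomputable def homBasis (b : Module.Basis (Fin 4) ℂ V) (d : ℕ) :
    Module.Basis (Finset.finsuppAntidiag (Finset.univ : Finset (Fin 4)) d) ℂ (homPoly V d) :=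
  (Module.Basis.span (homBasis_indep b d)).map (LinearEquiv.ofEq _ _ (homPoly_eq_span b d).symm)

lemma homBasis_apply (b : Module.Basis (Fin 4) ℂ V) (d : ℕ) (a) :
    ((homBasis b d a : homPoly V d) : V → ℂ) = coordEval b (MvPolynomial.monomial a.1 1) := by
  simp only [homBasis, Module.Basis.map_apply, LinearEquiv.coe_ofEq_apply]
  exact congrArg Subtype.val (Module.Basis.span_apply (homBasis_indep b d) a)

lemma homPoly_finite (hdim : Module.finrank ℂ V = 4) (d : ℕ) : FiniteDimensional ℂ (homPoly V d) :=
  Module.Basis.finiteDimensional_of_finite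
    (homBasis ((Module.finBasis ℂ V).reindex (finCongr hdim)) d)

lemma trace_of_diag {W ι : Type*} [AddCommGroup W] [Module ℂ W] [Fintype ι] [DecidableEq ι]
    (b : Module.Basis ι ℂ W) (T : Module.End ℂ W) (l : ι → ℂ) (h : ∀ i, T (b i) = l i • b i) :
    LinearMap.trace ℂ W T = ∑ i, l i := by
  rw [LinearMap.trace_eq_matrix_trace ℂ b, Matrix.trace]
  refine Finset.sum_congr rfl fun i _ => ?_
  simp [LinearMap.toMatrix_apply, h]

lemma eigen_data (hdim : Module.finrank ℂ V = 4) (T : Module.End ℂ V) (n : ℕ) (hn : n ≠ 0)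
    (hT : T ^ n = 1) : ∃ l : Fin 4 → ℂ, (∀ k, LinearMap.trace ℂ V (T ^ k) = ∑ i, l i ^ k) ∧
      LinearMap.det T = ∏ i, l i ∧ (∀ i, l i ^ n = 1) ∧
      ∀ (d : ℕ) (S : Module.End ℂ (homPoly V d)) (_ : ∀ f v, (S f).1 v = f.1 (T v)),
        LinearMap.trace ℂ _ S = ∑ a ∈ Finset.finsuppAntidiag (Finset.univ : Finset (Fin 4)) d,
          ∏ i, l i ^ a i := by
  obtain ⟨b, l, hb⟩ := exists_eigenbasis hdim T n hn hT
  have hk : ∀ k i, (T ^ k) (b i) = l i ^ k • b i := by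
    intro k i
    induction k with
    | zero => simp
    | succ k ih => rw [pow_succ', Module.End.mul_apply, ih, map_smul, hb, smul_smul, pow_succ]
  refine ⟨l, fun k => trace_of_diag b _ _ (hk k), ?_, ?_, ?_⟩
  · rw [← LinearMap.det_toMatrix b]
    have : LinearMap.toMatrix b b T = Matrix.diagonal l := by
      ext i j
      rw [LinearMap.toMatrix_apply, hb]
      simp [Matrix.diagonal_apply, Finsupp.single_apply]
      by_cases h : i = j <;> simp [h, eq_comm]
    rw [this, Matrix.det_diagonal]
  · intro i
    have h := hk n i
    rw [hT, Module.End.one_apply] at h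
    have h2 : (1 - l i ^ n) • b i = 0 := by rw [sub_smul, ← h]; simp
    rcases smul_eq_zero.1 h2 with h3 | h3
    · linear_combination -h3
    · exact absurd h3 (b.ne_zero i)
  · intro d S hS
    rw [← Finset.sum_coe_sort]
    apply trace_of_diag (homBasis b d)
    intro a
    have hc : ∀ i v, b.coord i (T v) = l i * b.coord i v := by
      intro i v
      have : (b.coord i) ∘ₗ T = l i • b.coord i := by
        apply b.ext
        intro j
        simp [hb, Finsupp.single_apply]
        by_cases h : j = i <;> simp [h]
      have := LinearMap.congr_fun this v
      simpa using this
    apply Subtype.ext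
    ext v
    rw [hS, homBasis_apply, Submodule.coe_smul, homBasis_apply, Pi.smul_apply,
      coordEval_apply, coordEval_apply]
    simp only [hc]
    rw [MvPolynomial.eval_monomial, MvPolynomial.eval_monomial,
      Finsupp.prod_fintype _ _ (by simp), Finsupp.prod_fintype _ _ (by simp)]
    simp [mul_pow, Finset.prod_mul_distrib]
end PolyTrace

section HRec
def hrec (e1 e2 e3 : ℂ) : ℕ → ℂ
  | 0 => 1
  | 1 => e1
  | 2 => e1 * e1 - e2
  | 3 => e1 * (e1 * e1 - e2) - e2 * e1 + e3
  | n + 4 => e1 * hrec e1 e2 e3 (n + 3) - e2 * hrec e1 e2 e3 (n + 2) + e3 * hrec e1 e2 e3 (n + 1)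
      - hrec e1 e2 e3 n

open PowerSeries in
lemma hsum_eq_hrec (l : Fin 4 → ℂ) (hl : ∏ i, l i = 1) (d : ℕ) :
    ∑ a ∈ Finset.finsuppAntidiag (Finset.univ : Finset (Fin 4)) d, ∏ i, l i ^ a i =
      hrec (∑ i, l i) (((∑ i, l i) ^ 2 - ∑ i, l i ^ 2) / 2) (∑ i, (l i)⁻¹) d := by
  set e1 := ∑ i, l i with he1
  set e2 := ((∑ i, l i) ^ 2 - ∑ i, l i ^ 2) / 2 with he2
  set e3 := ∑ i, (l i)⁻¹ with he3
  have hne : ∀ i, l i ≠ 0 := by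
    intro i h
    have := Finset.prod_eq_zero (Finset.mem_univ i) h
    rw [hl] at this; exact one_ne_zero this
  let S : PowerSeries ℂ := ∏ i, PowerSeries.mk (fun n => l i ^ n)
  have hS : ∀ d, PowerSeries.coeff d S =
      ∑ a ∈ Finset.finsuppAntidiag (Finset.univ : Finset (Fin 4)) d, ∏ i, l i ^ a i := by
    intro d
    simp only [S]
    rw [PowerSeries.coeff_prod]
    simp
  have h1 : ∀ i, (1 - PowerSeries.C (l i) * X) * PowerSeries.mk (fun n => l i ^ n) = 1 := by
    intro i
    ext n
    rw [sub_mul, one_mul, mul_assoc, map_sub, PowerSeries.coeff_C_mul]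
    cases n with
    | zero => simp
    | succ n => simp [PowerSeries.coeff_succ_X_mul, PowerSeries.coeff_one, pow_succ, mul_comm]
  have hP : (∏ i, (1 - PowerSeries.C (l i) * X)) * S = 1 := by
    rw [← Finset.prod_mul_distrib]
    simp [h1]
  have hq : (∏ i, (1 - PowerSeries.C (l i) * X) : PowerSeries ℂ) =
      1 - PowerSeries.C e1 * X + PowerSeries.C e2 * X ^ 2 - PowerSeries.C e3 * X ^ 3 + X ^ 4 := by
    have hh2 : e2 = l 0 * l 1 + l 0 * l 2 + l 0 * l 3 + l 1 * l 2 + l 1 * l 3 + l 2 * l 3 := by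
      rw [he2]; simp only [Fin.sum_univ_four]; ring
    have hh3 : e3 = l 0 * l 1 * l 2 + l 0 * l 1 * l 3 + l 0 * l 2 * l 3 + l 1 * l 2 * l 3 := by
      rw [he3]; simp only [Fin.sum_univ_four]
      rw [Fin.prod_univ_four] at hl
      have a0 := hne 0
      have a1 := hne 1
      have a2 := hne 2
      have a3 := hne 3
      have b0 : (l 0)⁻¹ = l 1 * l 2 * l 3 := by
        rw [eq_comm]; apply eq_inv_of_mul_eq_one_left; linear_combination hl
      have b1 : (l 1)⁻¹ = l 0 * l 2 * l 3 := by
        rw [eq_comm]; apply eq_inv_of_mul_eq_one_left; linear_combination hl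
      have b2 : (l 2)⁻¹ = l 0 * l 1 * l 3 := by
        rw [eq_comm]; apply eq_inv_of_mul_eq_one_left; linear_combination hl
      have b3 : (l 3)⁻¹ = l 0 * l 1 * l 2 := by
        rw [eq_comm]; apply eq_inv_of_mul_eq_one_left; linear_combination hl
      rw [b0, b1, b2, b3]; ring
    have hh4 : (PowerSeries.C (l 0) * PowerSeries.C (l 1) * PowerSeries.C (l 2) * PowerSeries.C (l 3) : PowerSeries ℂ) = 1 := by
      rw [← map_mul, ← map_mul, ← map_mul, ← Fin.prod_univ_four, hl, map_one]
    rw [hh2, hh3, he1]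
    simp only [Fin.sum_univ_four, Fin.prod_univ_four, map_add, map_mul]
    linear_combination X ^ 4 * hh4
  rw [hq] at hP
  have hexp : S = 1 + PowerSeries.C e1 * (X * S) - PowerSeries.C e2 * (X ^ 2 * S) + PowerSeries.C e3 * (X ^ 3 * S)
      - X ^ 4 * S := by linear_combination hP
  have hc : ∀ d, PowerSeries.coeff d S = hrec e1 e2 e3 d := by
    intro d
    induction d using Nat.strong_induction_on with
    | _ d ih =>
      have h := congrArg (PowerSeries.coeff d) hexp
      simp only [map_add, map_sub, PowerSeries.coeff_C_mul, PowerSeries.coeff_X_pow_mul', PowerSeries.coeff_one] at h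
      rw [← pow_one (X : PowerSeries ℂ)] at h
      simp only [PowerSeries.coeff_X_pow_mul'] at h
      rw [h]
      match d, ih with
      | 0, ih => simp [hrec]
      | 1, ih => simp [hrec, ih 0]
      | 2, ih => simp [hrec, ih 0, ih 1]
      | 3, ih => simp [hrec, ih 0, ih 1, ih 2]
      | n + 4, ih =>
        have a0 := ih n (by omega)
        have a1 := ih (n+1) (by omega)
        have a2 := ih (n+2) (by omega)
        have a3 := ih (n+3) (by omega)
        have t1 : n + 4 - 1 = n + 3 := by omega
        have t2 : n + 4 - 2 = n + 2 := by omega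
        have t3 : n + 4 - 3 = n + 1 := by omega
        simp [hrec, a0, a1, a2, a3, t2, t3]
  rw [← hS, hc]
end HRec

section LinAlg
variable {V : Type} [AddCommGroup V] [Module ℂ V] [FiniteDimensional ℂ V]
local notation "tr" => LinearMap.trace ℂ V

lemma idem_nat (E : Module.End ℂ V) (h : E * E = E) : ∃ m : ℕ, tr E = m :=
  ⟨_, (LinearMap.IsIdempotentElem.isProj_range E h).trace⟩

lemma avg_idem (T : Module.End ℂ V) (n : ℕ) (hn : n ≠ 0) (hT : T ^ n = 1) :
    T * ((n : ℂ)⁻¹ • ∑ k ∈ Finset.range n, T ^ k) = (n : ℂ)⁻¹ • ∑ k ∈ Finset.range n, T ^ k ∧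
    ((n : ℂ)⁻¹ • ∑ k ∈ Finset.range n, T ^ k) * ((n : ℂ)⁻¹ • ∑ k ∈ Finset.range n, T ^ k) =
      (n : ℂ)⁻¹ • ∑ k ∈ Finset.range n, T ^ k := by
  have h0 : T * (∑ k ∈ Finset.range n, T ^ k) = ∑ k ∈ Finset.range n, T ^ k := by
    have := mul_geom_sum T n
    rw [hT, sub_self, sub_mul, one_mul, sub_eq_zero] at this
    exact this
  have h1 : T * ((n : ℂ)⁻¹ • ∑ k ∈ Finset.range n, T ^ k) = (n : ℂ)⁻¹ • ∑ k ∈ Finset.range n, T ^ k := by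
    rw [mul_smul_comm, h0]
  refine ⟨h1, ?_⟩
  have h2 : ∀ k, T ^ k * ((n : ℂ)⁻¹ • ∑ k ∈ Finset.range n, T ^ k) = (n : ℂ)⁻¹ • ∑ k ∈ Finset.range n, T ^ k := by
    intro k
    induction k with
    | zero => simp
    | succ k ih => rw [pow_succ, mul_assoc, h1, ih]
  obtain ⟨E, hE⟩ : ∃ E, E = ((n : ℂ)⁻¹ • ∑ k ∈ Finset.range n, T ^ k) := ⟨_, rfl⟩
  rw [← hE] at h2 ⊢
  calc E * E = ((n : ℂ)⁻¹ • ∑ k ∈ Finset.range n, T ^ k) * E := by rw [← hE]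
    _ = E := by
      rw [smul_mul_assoc, Finset.sum_mul, Finset.sum_congr rfl (fun k _ => h2 k)]
      simp only [Finset.sum_const, Finset.card_range]
      rw [← Nat.cast_smul_eq_nsmul ℂ, smul_smul, inv_mul_cancel₀ (by exact_mod_cast hn), one_smul]

lemma avg_nat (T : Module.End ℂ V) (n : ℕ) (hn : n ≠ 0) (hT : T ^ n = 1) :
    ∃ m : ℕ, ∑ k ∈ Finset.range n, tr (T ^ k) = n * m := by
  obtain ⟨m, hm⟩ := idem_nat _ (avg_idem T n hn hT).2
  refine ⟨m, ?_⟩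
  rw [← hm, map_smul, map_sum, smul_eq_mul, mul_inv_cancel_left₀ (by exact_mod_cast hn)]

lemma avg_one (hdim : Module.finrank ℂ V = 4) (T : Module.End ℂ V) (n : ℕ) (hn : n ≠ 0)
    (hT : T ^ n = 1) (h : ∑ k ∈ Finset.range n, tr (T ^ k) = n * 4) : T = 1 := by
  obtain ⟨h1, h2⟩ := avg_idem T n hn hT
  have h3 : tr ((n : ℂ)⁻¹ • ∑ k ∈ Finset.range n, T ^ k) = 4 := by
    rw [map_smul, map_sum, smul_eq_mul, h, inv_mul_cancel_left₀ (by exact_mod_cast hn)]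
  generalize ((n : ℂ)⁻¹ • ∑ k ∈ Finset.range n, T ^ k) = E at *
  have h4 : 1 - E = 0 := by
    apply LinearMap.IsIdempotentElem.eq_zero_of_trace_eq_zero
    · exact IsIdempotentElem.one_sub h2
    · rw [map_sub, LinearMap.trace_one, hdim, h3]; norm_num
  rw [sub_eq_zero] at h4
  rw [← h4, mul_one] at h1
  exact h1

lemma exists_omega : ∃ w : ℂ, w ^ 2 = -1 - w := by
  have h := Complex.isPrimitiveRoot_exp 3 (by norm_num)
  refine ⟨Complex.exp (2 * Real.pi * Complex.I / (3 : ℕ)), ?_⟩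
  have h2 := h.geom_sum_eq_zero (by norm_num)
  simp only [Finset.sum_range_succ, Finset.sum_range_zero, pow_zero, pow_one] at h2
  linear_combination h2

/-- the joint multiplicity of eigenvalues -/
lemma joint_nat (α β γ : Module.End ℂ V) (hα : α * α = 1) (hβ : β * β = 1) (hαβ : α * β = β * α)
    (hγ : γ ^ 3 = 1) (hγα : γ * α = α * γ) (hγβ : γ * β = β * γ) (w s t : ℂ) (hw : w ^ 3 = 1)
    (hs : s ^ 2 = 1) (ht : t ^ 2 = 1) :
    ∃ m : ℕ, (tr 1 + s * tr α + t * tr β + s * t * tr (α * β))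
      + w * (tr γ + s * tr (γ * α) + t * tr (γ * β) + s * t * tr (γ * (α * β)))
      + w ^ 2 * (tr (γ ^ 2) + s * tr (γ ^ 2 * α) + t * tr (γ ^ 2 * β) + s * t * tr (γ ^ 2 * (α * β)))
      = 12 * m := by
  have hE := (avg_idem (w • γ) 3 (by norm_num) (by rw [smul_pow, hw, hγ, one_smul])).2
  have hF1 := (avg_idem (s • α) 2 (by norm_num) (by rw [smul_pow, hs, pow_two, hα, one_smul])).2
  have hF2 := (avg_idem (t • β) 2 (by norm_num) (by rw [smul_pow, ht, pow_two, hβ, one_smul])).2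
  set E := (((3 : ℕ) : ℂ)⁻¹ • ∑ k ∈ Finset.range 3, (w • γ) ^ k) with hEd
  set F := (((2 : ℕ) : ℂ)⁻¹ • ∑ k ∈ Finset.range 2, (s • α) ^ k) with hFd
  set H := (((2 : ℕ) : ℂ)⁻¹ • ∑ k ∈ Finset.range 2, (t • β) ^ k) with hHd
  have cγα : Commute γ α := hγα
  have cγβ : Commute γ β := hγβ
  have cαβ : Commute α β := hαβ
  have cEF : Commute E F := by
    apply Commute.smul_left; apply Commute.smul_right
    apply Commute.sum_left; intro i _; apply Commute.sum_right; intro j _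
    exact ((cγα.smul_left w).smul_right s).pow_pow i j
  have cEH : Commute E H := by
    apply Commute.smul_left; apply Commute.smul_right
    apply Commute.sum_left; intro i _; apply Commute.sum_right; intro j _
    exact ((cγβ.smul_left w).smul_right t).pow_pow i j
  have cFH : Commute F H := by
    apply Commute.smul_left; apply Commute.smul_right
    apply Commute.sum_left; intro i _; apply Commute.sum_right; intro j _
    exact ((cαβ.smul_left s).smul_right t).pow_pow i j
  have hFH : IsIdempotentElem (F * H) := IsIdempotentElem.mul_of_commute cFH hF1 hF2
  have hEFH : IsIdempotentElem (E * (F * H)) :=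
    IsIdempotentElem.mul_of_commute (cEF.mul_right cEH) hE hFH
  obtain ⟨m, hm⟩ := idem_nat _ hEFH
  refine ⟨m, ?_⟩
  rw [← hm, hEd, hFd, hHd]
  simp only [Finset.sum_range_succ, Finset.sum_range_zero, pow_zero, pow_one, zero_add, smul_pow]
  simp only [smul_mul_assoc, mul_smul_comm, mul_add, add_mul, mul_one, one_mul, map_add, map_smul,
    smul_eq_mul]
  push_cast
  ring

lemma split_contra (hdim : Module.finrank ℂ V = 4) (α β γ : Module.End ℂ V) (hα : α * α = 1)
    (hβ : β * β = 1) (hαβ : α * β = β * α)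
    (hγ : γ ^ 3 = 1) (hγα : γ * α = α * γ) (hγβ : γ * β = β * γ)
    (h0 : tr β = tr α) (h0' : tr (α * β) = tr α)
    (h1 : tr (γ * β) = tr (γ * α)) (h1' : tr (γ * (α * β)) = tr (γ * α))
    (h2 : tr (γ ^ 2 * β) = tr (γ ^ 2 * α)) (h2' : tr (γ ^ 2 * (α * β)) = tr (γ ^ 2 * α))
    (hx : tr (γ ^ 2) = tr γ) (hγ1 : γ ≠ 1) (hα1 : α ≠ 1) : False := by
  obtain ⟨w, hw⟩ := exists_omega
  have hw3 : w ^ 3 = 1 := by linear_combination (w - 1) * hw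
  have hJ := joint_nat α β γ hα hβ hαβ hγ hγα hγβ
  have ht1 : tr 1 = 4 := by rw [LinearMap.trace_one, hdim]; norm_num
  simp only [h0, h0', h1, h1', h2, h2', hx, ht1] at hJ
  obtain ⟨n0, hn0⟩ := hJ 1 1 1 (by norm_num) (by norm_num) (by norm_num)
  obtain ⟨n1, hn1⟩ := hJ w 1 1 hw3 (by norm_num) (by norm_num)
  obtain ⟨n2, hn2⟩ := hJ (w^2) 1 1 (by rw [← pow_mul, mul_comm, pow_mul, hw3, one_pow]) (by norm_num) (by norm_num)
  obtain ⟨m0, hm0⟩ := hJ 1 1 (-1) (by norm_num) (by norm_num) (by norm_num)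
  obtain ⟨m1, hm1⟩ := hJ w 1 (-1) hw3 (by norm_num) (by norm_num)
  obtain ⟨m2, hm2⟩ := hJ (w^2) 1 (-1) (by rw [← pow_mul, mul_comm, pow_mul, hw3, one_pow]) (by norm_num) (by norm_num)
  have hw4 : (w ^ 2) ^ 2 = w := by rw [← pow_mul]; linear_combination w * hw3
  rw [hw4] at hn2 hm2
  rw [hw] at hn1 hm1 hn2 hm2
  have e1 : ((n1 + 3 * m1 : ℕ) : ℂ) = (n2 + 3 * m2 : ℕ) := by
    push_cast
    linear_combination (-1/12) * hn1 + (-3/12) * hm1 + (1/12) * hn2 + (3/12) * hm2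
  have e2 : ((n0 + 3 * m0 + (n1 + 3 * m1) + (n2 + 3 * m2) : ℕ) : ℂ) = (4 : ℕ) := by
    push_cast
    linear_combination (-1/12) * hn1 + (-3/12) * hm1 + (-1/12) * hn2 + (-3/12) * hm2 + (-1/12) * hn0 + (-3/12) * hm0
  have e1' : n1 + 3 * m1 = n2 + 3 * m2 := by exact_mod_cast e1
  have e2' : n0 + 3 * m0 + (n1 + 3 * m1) + (n2 + 3 * m2) = 4 := by exact_mod_cast e2
  have hcase : (m0 = 0 ∧ m1 = 0 ∧ m2 = 0) ∨ (n0 + 3 * m0 = 4) := by omega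
  rcases hcase with ⟨rfl, rfl, rfl⟩ | h
  · apply hα1
    apply avg_one hdim α 2 (by norm_num) (by rw [pow_two, hα])
    simp only [Finset.sum_range_succ, Finset.sum_range_zero, pow_zero, pow_one, ht1]
    push_cast at hm0 hm1 hm2 ⊢
    linear_combination (-1/3) * (hm0 + hm1 + hm2)
  · apply hγ1
    apply avg_one hdim γ 3 (by norm_num) hγ
    simp only [Finset.sum_range_succ, Finset.sum_range_zero, pow_zero, pow_one, ht1, hx]
    have h' : (n0 : ℂ) + 3 * m0 = 4 := by exact_mod_cast h
    push_cast
    linear_combination (1/4) * (hn0 + 3 * hm0) + 3 * h'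

lemma quat_case (hdim : Module.finrank ℂ V = 4) (α γ : Module.End ℂ V) (hα : α * α = -1)
    (hγ : γ ^ 3 = 1) (hγα : γ * α = α * γ) (h0 : tr α = 0) (h1 : tr (γ * α) = 0)
    (h2 : tr (γ ^ 2 * α) = 0) (hx : tr (γ ^ 2) = tr γ) (hγ1 : γ ≠ 1) :
    tr γ = -2 ∧ γ ^ 2 = -1 - γ := by
  obtain ⟨w, hw⟩ := exists_omega
  have hw3 : w ^ 3 = 1 := by linear_combination (w - 1) * hw
  have ht1 : tr 1 = 4 := by rw [LinearMap.trace_one, hdim]; norm_num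
  have hα' : (Complex.I • α) * (Complex.I • α) = 1 := by
    rw [smul_mul_smul_comm, hα, Complex.I_mul_I]; simp
  have hJ := joint_nat (Complex.I • α) 1 γ hα' (by simp) (by simp) hγ (by simp [hγα]) (by simp)
  simp only [mul_one, mul_smul_comm, map_smul, h0, h1, h2, hx, ht1, smul_zero, mul_zero, add_zero] at hJ
  obtain ⟨n0, hn0⟩ := hJ 1 1 1 (by norm_num) (by norm_num) (by norm_num)
  obtain ⟨n1, hn1⟩ := hJ w 1 1 hw3 (by norm_num) (by norm_num)
  rw [hw] at hn1
  have e2 : ((n0 + 2 * n1 : ℕ) : ℂ) = (2 : ℕ) := by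
    push_cast
    linear_combination (-1/12) * hn0 + (-2/12) * hn1
  have e2' : n0 + 2 * n1 = 2 := by exact_mod_cast e2
  have hcase : (n0 = 2) ∨ (n0 = 0) := by omega
  rcases hcase with rfl | rfl
  · exfalso
    apply hγ1
    apply avg_one hdim γ 3 (by norm_num) hγ
    simp only [Finset.sum_range_succ, Finset.sum_range_zero, pow_zero, pow_one, ht1, hx]
    push_cast at hn0 ⊢
    linear_combination (1/2) * hn0
  · have ht : tr γ = -2 := by
      push_cast at hn0
      linear_combination (1/4) * hn0
    refine ⟨ht, ?_⟩
    have hE := (avg_idem γ 3 (by norm_num) hγ).2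
    have := LinearMap.IsIdempotentElem.eq_zero_of_trace_eq_zero hE (by
      rw [map_smul, map_sum]
      simp only [Finset.sum_range_succ, Finset.sum_range_zero, pow_zero, pow_one, ht1, hx, ht]
      norm_num)
    rw [smul_eq_zero] at this
    rcases this with h | h
    · norm_num at h
    · simp only [Finset.sum_range_succ, Finset.sum_range_zero, pow_zero, pow_one, zero_add] at h
      rw [← sub_eq_zero, ← h]; abel

lemma five_case (hdim : Module.finrank ℂ V = 4) (γ : Module.End ℂ V)
    (hγ : γ ^ 5 = 1) (h2 : tr (γ ^ 2) = tr γ) (h3 : tr (γ ^ 3) = tr γ) (h4 : tr (γ ^ 4) = tr γ)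
    (hγ1 : γ ≠ 1) : tr γ = -1 := by
  have hp := Complex.isPrimitiveRoot_exp 5 (by norm_num)
  set w := Complex.exp (2 * Real.pi * Complex.I / (5 : ℕ))
  have hw5 : w ^ 5 = 1 := hp.pow_eq_one
  have hws := hp.geom_sum_eq_zero (by norm_num)
  have ht1 : tr 1 = 4 := by rw [LinearMap.trace_one, hdim]; norm_num
  obtain ⟨n0, hn0⟩ := avg_nat γ 5 (by norm_num) hγ
  obtain ⟨n1, hn1⟩ := avg_nat (w • γ) 5 (by norm_num) (by rw [smul_pow, hw5, hγ, one_smul])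
  simp only [Finset.sum_range_succ, Finset.sum_range_zero, pow_zero, pow_one, ht1, h2, h3, h4, smul_pow, map_smul, smul_eq_mul] at hn0 hn1 hws
  push_cast at hn0 hn1
  have e2 : ((n0 + 4 * n1 : ℕ) : ℂ) = (4 : ℕ) := by
    push_cast
    linear_combination (-1/5) * hn0 + (-4/5) * hn1 + (4/5) * tr γ * hws
  have e2' : n0 + 4 * n1 = 4 := by exact_mod_cast e2
  have hcase : (n0 = 4) ∨ (n0 = 0) := by omega
  rcases hcase with rfl | rfl
  · exfalso
    apply hγ1
    apply avg_one hdim γ 5 (by norm_num) hγ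
    simp only [Finset.sum_range_succ, Finset.sum_range_zero, pow_zero, pow_one, ht1, h2, h3, h4]
    push_cast at hn0 ⊢
    linear_combination hn0
  · push_cast at hn0
    linear_combination (1/4) * hn0

lemma seven_case (hdim : Module.finrank ℂ V = 4) (γ : Module.End ℂ V)
    (hγ : γ ^ 7 = 1) (h2 : tr (γ ^ 2) = tr γ) (h4 : tr (γ ^ 4) = tr γ)
    (h5 : tr (γ ^ 5) = tr (γ ^ 3)) (h6 : tr (γ ^ 6) = tr (γ ^ 3))
    (hγ1 : γ ≠ 1) : tr γ + tr (γ ^ 6) = 1 ∧ tr γ ^ 2 = tr γ - 2 := by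
  have hp := Complex.isPrimitiveRoot_exp 7 (by norm_num)
  set w := Complex.exp (2 * Real.pi * Complex.I / (7 : ℕ))
  have hw7 : w ^ 7 = 1 := hp.pow_eq_one
  have hws := hp.geom_sum_eq_zero (by norm_num)
  have ht1 : tr 1 = 4 := by rw [LinearMap.trace_one, hdim]; norm_num
  obtain ⟨n0, hn0⟩ := avg_nat γ 7 (by norm_num) hγ
  obtain ⟨n1, hn1⟩ := avg_nat (w • γ) 7 (by norm_num) (by rw [smul_pow, hw7, hγ, one_smul])
  obtain ⟨n2, hn2⟩ := avg_nat (w ^ 3 • γ) 7 (by norm_num)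
    (by rw [smul_pow, ← pow_mul, mul_comm, pow_mul, hw7, hγ, one_pow, one_smul])
  have hα : ∃ x, tr γ = x := ⟨_, rfl⟩
  have hβ : ∃ x, tr (γ ^ 3) = x := ⟨_, rfl⟩
  obtain ⟨x, hx⟩ := hα
  obtain ⟨y, hy⟩ := hβ
  simp only [Finset.sum_range_succ, Finset.sum_range_zero, pow_zero, pow_one, ht1, h2, h4, h5, h6, hx, hy, smul_pow, map_smul, smul_eq_mul] at hn0 hn1 hn2 hws ⊢
  push_cast at hn0 hn1 hn2
  -- reduce powers
  have p9 : w ^ 9 = w ^ 2 := by linear_combination w ^ 2 * hw7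
  have q2 : (w ^ 3) ^ 2 = w ^ 6 := by ring
  have q3 : (w ^ 3) ^ 3 = w ^ 2 := by linear_combination w ^ 2 * hw7
  have q4 : (w ^ 3) ^ 4 = w ^ 5 := by linear_combination w ^ 5 * hw7
  have q5 : (w ^ 3) ^ 5 = w := by linear_combination (w ^ 8 + w) * hw7
  have q6 : (w ^ 3) ^ 6 = w ^ 4 := by linear_combination (w ^ 11 + w ^ 4) * hw7
  rw [q2, q3, q4, q5, q6] at hn2
  obtain ⟨s, hs⟩ : ∃ s, s = w + w ^ 2 + w ^ 4 := ⟨_, rfl⟩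
  have hs' : w ^ 3 + w ^ 5 + w ^ 6 = -1 - s := by rw [hs]; linear_combination hws
  have hss : s ^ 2 = -s - 2 := by
    rw [hs]
    linear_combination w * hw7 + 2 * hws
  have f1 : 4 + s * x + (-1 - s) * y = 7 * n1 := by
    rw [← hs', hs]; linear_combination hn1
  have f2 : 4 + (-1 - s) * x + s * y = 7 * n2 := by
    rw [← hs', hs]; linear_combination hn2
  have f0 : 4 + 3 * x + 3 * y = 7 * n0 := by linear_combination hn0
  have e2 : ((n0 + 3 * n1 + 3 * n2 : ℕ) : ℂ) = (4 : ℕ) := by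
    push_cast
    linear_combination (-1/7) * f0 + (-3/7) * f1 + (-3/7) * f2
  have e2' : n0 + 3 * n1 + 3 * n2 = 4 := by exact_mod_cast e2
  have hcase : (n0 = 4) ∨ (n0 = 1 ∧ n1 = 1 ∧ n2 = 0) ∨ (n0 = 1 ∧ n1 = 0 ∧ n2 = 1) := by omega
  rcases hcase with rfl | ⟨rfl, rfl, rfl⟩ | ⟨rfl, rfl, rfl⟩
  · exfalso
    apply hγ1
    apply avg_one hdim γ 7 (by norm_num) hγ
    simp only [Finset.sum_range_succ, Finset.sum_range_zero, pow_zero, pow_one, ht1, h2, h4, h5, h6, hx, hy]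
    push_cast at f0 ⊢
    linear_combination f0
  · push_cast at f0 f1 f2
    have g1 : x + y = 1 := by linear_combination (1/3) * f0
    refine ⟨g1, ?_⟩
    have hy' : y = 1 - x := by linear_combination g1
    subst hy'
    have k : (2 * s + 1) * (2 * s + 1) = -7 := by linear_combination 4 * hss
    have hxs : x = - s := by
      linear_combination (-1/7) * (2 * s + 1) * f1 + (1/7) * x * k - (2/7) * hss
    rw [hxs]; linear_combination hss
  · push_cast at f0 f1 f2
    have g1 : x + y = 1 := by linear_combination (1/3) * f0
    refine ⟨g1, ?_⟩
    have hy' : y = 1 - x := by linear_combination g1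
    subst hy'
    have k : (2 * s + 1) * (2 * s + 1) = -7 := by linear_combination 4 * hss
    have hxs : x = s + 1 := by
      linear_combination (-1/7) * (2 * s + 1) * f1 + (1/7) * x * k - (2/7) * hss
    rw [hxs]; linear_combination hss
end LinAlg

section Cover
set_option linter.unusedSectionVars false
variable {G : Type} [Group G] {V : Type} [AddCommGroup V] [Module ℂ V] [FiniteDimensional ℂ V]

/-- the data extracted from a double cover of `A₇` and a faithful representation -/
structure Cov (p : G →* Equiv.Perm (Fin 7)) (z : G) (ρ : Representation ℂ G V) : Prop where
  surj : ∀ a, Equiv.Perm.sign a = 1 → ∃ g, p g = a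
  pz : p z = 1
  ker : ∀ g, p g = 1 → g = 1 ∨ g = z
  hz : ρ z = -1
  z2 : z * z = 1
  zc : ∀ g, z * g = g * z
  inj : Function.Injective ρ
  dim : Module.finrank ℂ V = 4

/-- the character -/
noncomputable def chi (ρ : Representation ℂ G V) (g : G) : ℂ := LinearMap.trace ℂ V (ρ g)

def q7 (f g : Fin 7 → Fin 7) (h : (∀ x, g (f x) = x) ∧ (∀ x, f (g x) = x) := by decide) :
    Equiv.Perm (Fin 7) := ⟨f, g, h.1, h.2⟩

def pa : Equiv.Perm (Fin 7) := q7 ![1,0,3,2,4,5,6] ![1,0,3,2,4,5,6]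
def pb : Equiv.Perm (Fin 7) := q7 ![2,3,0,1,4,5,6] ![2,3,0,1,4,5,6]
def pc : Equiv.Perm (Fin 7) := q7 ![0,1,2,3,5,6,4] ![0,1,2,3,6,4,5]
def pd : Equiv.Perm (Fin 7) := q7 ![0,2,3,1,4,5,6] ![0,3,1,2,4,5,6]
def pc0 : Equiv.Perm (Fin 7) := q7 ![1,2,0,3,4,5,6] ![2,0,1,3,4,5,6]
def pc1 : Equiv.Perm (Fin 7) := q7 ![0,1,2,4,5,3,6] ![0,1,2,5,3,4,6]
def ph : Equiv.Perm (Fin 7) := q7 ![2,3,4,1,0,6,5] ![4,3,0,1,2,6,5]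
def pf : Equiv.Perm (Fin 7) := q7 ![1,2,3,4,0,5,6] ![4,0,1,2,3,5,6]
def pe : Equiv.Perm (Fin 7) := q7 ![1,2,3,4,5,6,0] ![6,0,1,2,3,4,5]

namespace Cov
variable {p : G →* Equiv.Perm (Fin 7)} {z : G} {ρ : Representation ℂ G V} (H : Cov p z ρ)
include H

lemma one_ne_neg : (1 : Module.End ℂ V) ≠ -1 := by
  intro h
  have := congrArg (LinearMap.trace ℂ V) h
  rw [map_neg, LinearMap.trace_one, H.dim] at this
  norm_num at this

lemma z_ne : z ≠ 1 := by
  intro h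
  have := H.hz
  rw [h, map_one] at this
  exact H.one_ne_neg this

lemma eq_or {g h : G} (e : p g = p h) : g = h ∨ g = z * h := by
  rcases H.ker (g * h⁻¹) (by rw [map_mul, map_inv, e, mul_inv_cancel]) with h1 | h1
  · left; exact mul_inv_eq_one.1 h1
  · right; exact mul_inv_eq_iff_eq_mul.1 h1

lemma zpow_odd (g : G) {n : ℕ} (hn : Odd n) : (z * g) ^ n = z * g ^ n := by
  have hc : Commute z g := H.zc g
  rw [hc.mul_pow]
  obtain ⟨k, rfl⟩ := hn
  rw [pow_succ z, pow_mul, pow_two, H.z2, one_pow, one_mul]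

lemma odd_eq {g h : G} {n : ℕ} (hn : Odd n) (hg : g ^ n = 1) (hh : h ^ n = 1) (e : p g = p h) :
    g = h := by
  rcases H.eq_or e with h1 | h1
  · exact h1
  · rw [h1, H.zpow_odd h hn, hh, mul_one] at hg
    exact absurd hg H.z_ne

lemma lift_odd {a : Equiv.Perm (Fin 7)} (ha : Equiv.Perm.sign a = 1) {n : ℕ} (hn : Odd n)
    (han : a ^ n = 1) : ∃ g, p g = a ∧ g ^ n = 1 := by
  obtain ⟨g, hg⟩ := H.surj a ha
  rcases H.ker (g ^ n) (by rw [map_pow, hg, han]) with h | h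
  · exact ⟨g, hg, h⟩
  · exact ⟨z * g, by rw [map_mul, H.pz, hg, one_mul], by rw [H.zpow_odd g hn, h, H.z2]⟩

lemma chi_conj (k g : G) : chi ρ (k * g * k⁻¹) = chi ρ g := by
  unfold chi
  rw [map_mul, LinearMap.trace_mul_comm, ← map_mul, ← mul_assoc, inv_mul_cancel, one_mul]

lemma chi_z (g : G) : chi ρ (z * g) = - chi ρ g := by
  unfold chi
  rw [map_mul, H.hz, neg_one_mul, map_neg]

lemma chi_odd {g h : G} {n : ℕ} (hn : Odd n) (hg : g ^ n = 1) (hh : h ^ n = 1)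
    (s : Equiv.Perm (Fin 7)) (hs : Equiv.Perm.sign s = 1) (e : s * p h = p g * s) :
    chi ρ g = chi ρ h := by
  obtain ⟨k, rfl⟩ := H.surj s hs
  have : g = k * h * k⁻¹ := by
    apply H.odd_eq hn hg
    · rw [conj_pow, hh]; simp
    · rw [map_mul, map_mul, map_inv, e]; simp
  rw [this, H.chi_conj]

lemma conj_or {g h : G} (s : Equiv.Perm (Fin 7)) (hs : Equiv.Perm.sign s = 1)
    (e : s * p h = p g * s) : ∃ k, g = k * h * k⁻¹ ∨ g = z * (k * h * k⁻¹) := by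
  obtain ⟨k, rfl⟩ := H.surj s hs
  refine ⟨k, H.eq_or ?_⟩
  rw [map_mul, map_mul, map_inv, e]; simp

lemma chi_zero {g h : G} (s : Equiv.Perm (Fin 7)) (hs : Equiv.Perm.sign s = 1)
    (e : s * p h = p g * s) (h0 : chi ρ h = 0) : chi ρ g = 0 := by
  obtain ⟨k, h1 | h1⟩ := H.conj_or s hs e
  · rw [h1, H.chi_conj, h0]
  · rw [h1, H.chi_z, H.chi_conj, h0, neg_zero]

lemma sq_conj {g h : G} (s : Equiv.Perm (Fin 7)) (hs : Equiv.Perm.sign s = 1)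
    (e : s * p h = p g * s) (w : G) (hw : ∀ k, k * w * k⁻¹ = w) (h0 : h * h = w) : g * g = w := by
  obtain ⟨k, h1 | h1⟩ := H.conj_or s hs e
  · rw [h1, ← hw k, ← h0]; group
  · have h2 : ∀ x : G, (z * x) * (z * x) = x * x := by
      intro x
      calc (z * x) * (z * x) = (x * z) * (z * x) := by rw [H.zc]
        _ = x * (z * z) * x := by group
        _ = x * x := by rw [H.z2, mul_one]
    rw [h1, h2, ← hw k, ← h0]; group

lemma c_inv {C : G} (hC : p C = pc) (hC3 : C ^ 3 = 1) : chi ρ (C ^ 2) = chi ρ C := by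
  refine H.chi_odd (n := 3) (by decide) ?_ hC3 (q7 ![0,1,3,2,4,6,5] ![0,1,3,2,4,6,5]) (by decide) ?_
  · rw [← pow_mul, mul_comm, pow_mul, hC3, one_pow]
  · rw [map_pow, hC]; decide

lemma rho_ne {g : G} (h : p g ≠ 1) : ρ g ≠ 1 := by
  intro h1
  have : g = 1 := H.inj (by rw [h1, map_one])
  rw [this, map_one] at h
  exact h rfl

lemma a_sq {A : G} (hA : p A = pa) : A * A = z := by
  rcases H.ker (A * A) (by rw [map_mul, hA]; decide) with h1 | h1
  swap
  · exact h1
  exfalso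
  obtain ⟨D, hD, hD3⟩ := H.lift_odd (a := pd) (n := 3) (by decide) (by decide) (by decide)
  obtain ⟨C, hC, hC3⟩ := H.lift_odd (a := pc) (n := 3) (by decide) (by decide) (by decide)
  -- normalise A
  obtain ⟨A, hA, h1, hn⟩ : ∃ A, p A = pa ∧ A * A = 1 ∧
      D * (D * A * D⁻¹) * D⁻¹ = A * (D * A * D⁻¹) := by
    have e : p (D * (D * A * D⁻¹) * D⁻¹) = p (A * (D * A * D⁻¹)) := by
      simp only [map_mul, map_inv, hA, hD]; decide
    rcases H.eq_or e with h2 | h2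
    · exact ⟨A, hA, h1, h2⟩
    · refine ⟨z * A, by rw [map_mul, H.pz, hA, one_mul], ?_, ?_⟩
      · calc z * A * (z * A) = (z * A) * (A * z) := by rw [H.zc A]
          _ = z * (A * A) * z := by group
          _ = 1 := by rw [h1, mul_one, H.z2]
      · have h3 : ∀ x : G, D * (z * x) * D⁻¹ = z * (D * x * D⁻¹) := by
          intro x
          rw [← mul_assoc D z, ← H.zc D]; group
        rw [h3, h3, h2]
        calc z * (z * (A * (D * A * D⁻¹))) = z * ((z * A) * (D * A * D⁻¹)) := by group
          _ = z * ((A * z) * (D * A * D⁻¹)) := by rw [H.zc A]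
          _ = _ := by group
  obtain ⟨B, hB⟩ : ∃ B, B = D * A * D⁻¹ := ⟨_, rfl⟩
  rw [← hB] at hn
  have hB2 : B * B = 1 := by
    calc B * B = D * (A * A) * D⁻¹ := by rw [hB]; group
      _ = 1 := by rw [h1]; group
  have hAB2 : (A * B) * (A * B) = 1 := by
    calc (A * B) * (A * B) = D * (B * B) * D⁻¹ := by rw [← hn]; group
      _ = 1 := by rw [hB2]; group
  have hAB : A * B = B * A := by
    have hAi : A⁻¹ = A := inv_eq_of_mul_eq_one_right h1
    have hBi : B⁻¹ = B := inv_eq_of_mul_eq_one_right hB2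
    have := inv_eq_of_mul_eq_one_right hAB2
    rw [mul_inv_rev, hAi, hBi] at this
    exact this.symm
  have hpB : p B = pb := by
    rw [hB]; simp only [map_mul, map_inv, hA, hD]; decide
  have comm : ∀ g, p (g * C * g⁻¹) = pc → g * C = C * g := by
    intro g hg
    have : g * C * g⁻¹ = C := by
      apply H.odd_eq (n := 3) (by decide)
      · rw [conj_pow, hC3]; simp
      · exact hC3
      · rw [hg, hC]
    exact mul_inv_eq_iff_eq_mul.1 this
  have cA : A * C = C * A := comm A (by simp only [map_mul, map_inv, hA, hC]; decide)
  have cB : B * C = C * B := comm B (by simp only [map_mul, map_inv, hpB, hC]; decide)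
  have cD : D * C = C * D := comm D (by simp only [map_mul, map_inv, hD, hC]; decide)
  have cD' : ∀ k, D * C ^ k * D⁻¹ = C ^ k := by
    intro k
    have : Commute D C := cD
    rw [(this.pow_right k).eq, mul_inv_cancel_right]
  have t1 : ∀ k, chi ρ (C ^ k * B) = chi ρ (C ^ k * A) := by
    intro k
    rw [← H.chi_conj D (C ^ k * A)]
    congr 1
    rw [hB]
    calc C ^ k * (D * A * D⁻¹) = D * C ^ k * D⁻¹ * (D * A * D⁻¹) := by rw [cD']
      _ = _ := by group
  have t2 : ∀ k, chi ρ (C ^ k * (A * B)) = chi ρ (C ^ k * A) := by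
    intro k
    rw [← t1, ← H.chi_conj D (C ^ k * B)]
    congr 1
    rw [← hn]
    calc C ^ k * (D * B * D⁻¹) = D * C ^ k * D⁻¹ * (D * B * D⁻¹) := by rw [cD']
      _ = _ := by group
  have hc := H.c_inv hC hC3
  have s0 := t1 0
  have s0' := t2 0
  have s1 := t1 1
  have s1' := t2 1
  have s2 := t1 2
  have s2' := t2 2
  simp only [chi, map_mul, map_pow, pow_zero, pow_one, one_mul] at hc s0 s0' s1 s1' s2 s2'
  refine split_contra H.dim (ρ A) (ρ B) (ρ C) ?_ ?_ ?_ ?_ ?_ ?_ s0 s0' s1 s1' s2 s2' hc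
    (H.rho_ne (by rw [hC]; decide)) (H.rho_ne (by rw [hA]; decide))
  · rw [← map_mul, h1, map_one]
  · rw [← map_mul, hB2, map_one]
  · rw [← map_mul, hAB, map_mul]
  · rw [← map_pow, hC3, map_one]
  · rw [← map_mul, ← cA, map_mul]
  · rw [← map_mul, ← cB, map_mul]

lemma z_conj (k : G) : k * z * k⁻¹ = z := by rw [← H.zc k]; group

lemma ab_anti : ∃ A B : G, p A = pa ∧ p B = pb ∧ A * B * A⁻¹ = z * B := by
  obtain ⟨A, hA⟩ := H.surj pa (by decide)
  obtain ⟨B, hB⟩ := H.surj pb (by decide)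
  refine ⟨A, B, hA, hB, ?_⟩
  have hA2 := H.a_sq hA
  have hB2 : B * B = z := H.sq_conj (q7 ![0,2,1,3,4,6,5] ![0,2,1,3,4,6,5]) (by decide)
    (by rw [hA, hB]; decide) z H.z_conj hA2
  have hAB2 : (A * B) * (A * B) = z := H.sq_conj (q7 ![0,3,1,2,4,5,6] ![0,2,3,1,4,5,6]) (by decide)
    (by rw [map_mul, hA, hB]; decide) z H.z_conj hA2
  have h1 : A * B * A = z * B⁻¹ := by
    rw [eq_mul_inv_iff_mul_eq, ← hAB2]; group
  have h2 : B⁻¹ = z * B := by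
    rw [inv_eq_iff_mul_eq_one, ← mul_assoc, ← H.zc, mul_assoc, hB2, H.z2]
  have h3 : A⁻¹ = A * z := by
    rw [inv_eq_iff_mul_eq_one, ← mul_assoc, hA2, H.z2]
  rw [h3, ← mul_assoc, h1, h2, ← mul_assoc, H.z2, one_mul, H.zc]

lemma chi_a {A : G} (hA : p A = pa) : chi ρ A = 0 := by
  obtain ⟨A', B, hA', hB, h⟩ := H.ab_anti
  have hB0 : chi ρ B = 0 := by
    have := H.chi_conj A' B
    rw [h, H.chi_z] at this
    linear_combination (-1/2) * this
  exact H.chi_zero (q7 ![0,2,1,3,4,6,5] ![0,2,1,3,4,6,5]) (by decide) (by rw [hA, hB]; decide) hB0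

lemma chi_bc {B C : G} (hB : p B = pb) (hC : p C = pc) (hC3 : C ^ 3 = 1) (k : ℕ) :
    chi ρ (C ^ k * B) = 0 := by
  obtain ⟨A', B', hA', hB', h⟩ := H.ab_anti
  have h' : A' * B * A'⁻¹ = z * B := by
    rcases H.eq_or (hB.trans hB'.symm) with rfl | rfl
    · exact h
    · calc A' * (z * B') * A'⁻¹ = (A' * z * A'⁻¹) * (A' * B' * A'⁻¹) := by group
        _ = _ := by rw [h, H.z_conj]
  have hc : A' * C * A'⁻¹ = C := by
    apply H.odd_eq (n := 3) (by decide)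
    · rw [conj_pow, hC3]; simp
    · exact hC3
    · simp only [map_mul, map_inv, hA', hC]; decide
  have := H.chi_conj A' (C ^ k * B)
  have e : A' * (C ^ k * B) * A'⁻¹ = z * (C ^ k * B) := by
    calc A' * (C ^ k * B) * A'⁻¹ = (A' * C * A'⁻¹) ^ k * (A' * B * A'⁻¹) := by
          rw [conj_pow]; group
      _ = C ^ k * z * B := by rw [hc, h']; group
      _ = _ := by rw [← H.zc]; group
  rw [e, H.chi_z] at this
  linear_combination (-1/2) * this

lemma chi_c {C : G} (hC : p C = pc) (hC3 : C ^ 3 = 1) :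
    chi ρ C = -2 ∧ ρ C ^ 2 = -1 - ρ C := by
  obtain ⟨B, hB⟩ := H.surj pb (by decide)
  obtain ⟨A, hA⟩ := H.surj pa (by decide)
  have hB2 : B * B = z := H.sq_conj (q7 ![0,2,1,3,4,6,5] ![0,2,1,3,4,6,5]) (by decide)
    (by rw [hA, hB]; decide) z H.z_conj (H.a_sq hA)
  have hc : B * C * B⁻¹ = C := by
    apply H.odd_eq (n := 3) (by decide)
    · rw [conj_pow, hC3]; simp
    · exact hC3
    · simp only [map_mul, map_inv, hB, hC]; decide
  have hc2 := mul_inv_eq_iff_eq_mul.1 hc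
  have s0 := H.chi_bc hB hC hC3 0
  have s1 := H.chi_bc hB hC hC3 1
  have s2 := H.chi_bc hB hC hC3 2
  have s := H.c_inv hC hC3
  simp only [chi, map_mul, map_pow, pow_zero, pow_one, one_mul] at s s0 s1 s2
  refine quat_case H.dim (ρ B) (ρ C) ?_ ?_ ?_ s0 s1 s2 s (H.rho_ne (by rw [hC]; decide))
  · rw [← map_mul, hB2, H.hz]
  · rw [← map_pow, hC3, map_one]
  · rw [← map_mul, ← hc2, map_mul]

lemma chi_c' {C : G} {x : Equiv.Perm (Fin 7)} (hC : p C = x) (hC3 : C ^ 3 = 1)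
    (s : Equiv.Perm (Fin 7)) (hs : Equiv.Perm.sign s = 1) (e : s * pc = x * s) :
    chi ρ C = -2 ∧ ρ C ^ 2 = -1 - ρ C := by
  obtain ⟨C', hC', hC3'⟩ := H.lift_odd (a := pc) (n := 3) (by decide) (by decide) (by decide)
  obtain ⟨h1, h2⟩ := H.chi_c hC' hC3'
  obtain ⟨k, rfl⟩ := H.surj s hs
  have : C = k * C' * k⁻¹ := by
    apply H.odd_eq (n := 3) (by decide) hC3
    · rw [conj_pow, hC3']; simp
    · rw [map_mul, map_mul, map_inv, hC', e, hC]; simp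
  rw [this, H.chi_conj]
  refine ⟨h1, ?_⟩
  rw [← map_pow, conj_pow, map_mul, map_mul, map_pow, h2]
  rw [mul_sub, mul_neg, mul_one, sub_mul, neg_mul, ← map_mul, mul_inv_cancel, map_one, map_mul, map_mul]

lemma chi_6 {g : G} (s : Equiv.Perm (Fin 7)) (hs : Equiv.Perm.sign s = 1)
    (e : s * (pa * pc) = p g * s) : chi ρ g = 0 := by
  obtain ⟨B, hB⟩ := H.surj pb (by decide)
  obtain ⟨C, hC, hC3⟩ := H.lift_odd (a := pc) (n := 3) (by decide) (by decide) (by decide)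
  have h1 := H.chi_bc hB hC hC3 1
  refine H.chi_zero (s * q7 ![0,2,1,3,4,5,6] ![0,2,1,3,4,5,6] * q7 ![2,1,0,3,4,5,6] ![2,1,0,3,4,5,6]) ?_ ?_ h1
  · simp only [map_mul, hs]; decide
  · rw [pow_one, map_mul, hB, hC, mul_assoc, mul_assoc]
    have : q7 ![0,2,1,3,4,5,6] ![0,2,1,3,4,5,6] * (q7 ![2,1,0,3,4,5,6] ![2,1,0,3,4,5,6] * (pc * pb)) =
      (pa * pc) * (q7 ![0,2,1,3,4,5,6] ![0,2,1,3,4,5,6] * q7 ![2,1,0,3,4,5,6] ![2,1,0,3,4,5,6]) := by decide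
    rw [this, ← mul_assoc, e]; group
end Cov
end Cover

section Values
set_option linter.unusedSectionVars false
variable {G : Type} [Group G] [Finite G] {V : Type} [AddCommGroup V] [Module ℂ V] [FiniteDimensional ℂ V]

/-- the character of the `d`-th symmetric power -/
noncomputable def psi (ρ : Representation ℂ G V) (d : ℕ) (g : G) : ℂ :=
  hrec (chi ρ g) ((chi ρ g ^ 2 - chi ρ (g * g)) / 2) (chi ρ g⁻¹) d

lemma chi_inv (hdim : Module.finrank ℂ V = 4) (ρ : Representation ℂ G V) (g : G) :
    chi ρ g⁻¹ = star (chi ρ g) := by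
  have hn : Nat.card G ≠ 0 := Nat.card_pos.ne'
  have hg : ρ g ^ (Nat.card G) = 1 := by rw [← map_pow, pow_card_eq_one', map_one]
  obtain ⟨l, h1, -, h3, -⟩ := eigen_data hdim (ρ g) _ hn hg
  have e : g⁻¹ = g ^ (Nat.card G - 1) := by
    rw [inv_eq_iff_mul_eq_one, ← pow_succ', Nat.sub_add_cancel (Nat.one_le_iff_ne_zero.2 hn), pow_card_eq_one']
  have h4 := h1 1
  simp only [pow_one] at h4
  unfold chi
  rw [e, map_pow, h1, h4, star_sum]
  refine Finset.sum_congr rfl fun i _ => ?_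
  have hnorm : ‖l i‖ = 1 := Complex.norm_eq_one_of_pow_eq_one (h3 i) hn
  have h0 : l i ≠ 0 := by intro h; rw [h] at hnorm; simp at hnorm
  have h5 : l i ^ (Nat.card G - 1) = (l i)⁻¹ := by
    apply eq_inv_of_mul_eq_one_left
    rw [← pow_succ, Nat.sub_add_cancel (Nat.one_le_iff_ne_zero.2 hn), h3]
  rw [h5, Complex.inv_eq_conj hnorm]; rfl

namespace Cov
variable {p : G →* Equiv.Perm (Fin 7)} {z : G} {ρ : Representation ℂ G V} (H : Cov p z ρ)
include H

lemma psi_conj (d : ℕ) (k g : G) : psi ρ d (k * g * k⁻¹) = psi ρ d g := by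
  unfold psi
  have h1 : k * g * k⁻¹ * (k * g * k⁻¹) = k * (g * g) * k⁻¹ := by group
  have h2 : (k * g * k⁻¹)⁻¹ = k * g⁻¹ * k⁻¹ := by group
  rw [h1, h2, H.chi_conj, H.chi_conj, H.chi_conj]

lemma hrec_neg (e1 e2 e3 : ℂ) (d : ℕ) : hrec (-e1) e2 (-e3) d = (-1) ^ d * hrec e1 e2 e3 d := by
  induction d using Nat.strong_induction_on with
  | _ d ih =>
    match d, ih with
    | 0, ih => simp [hrec]
    | 1, ih => simp [hrec]
    | 2, ih => simp [hrec]
    | 3, ih => simp only [hrec]; ring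
    | n + 4, ih =>
      rw [hrec, hrec, ih n (by omega), ih (n+1) (by omega), ih (n+2) (by omega), ih (n+3) (by omega)]
      ring

lemma psi_z (d : ℕ) (g : G) : psi ρ d (z * g) = (-1) ^ d * psi ρ d g := by
  unfold psi
  have h1 : z * g * (z * g) = g * g := by
    calc z * g * (z * g) = g * z * (z * g) := by rw [H.zc]
      _ = g * (z * z) * g := by group
      _ = _ := by rw [H.z2, mul_one]
  have h2 : (z * g)⁻¹ = z * g⁻¹ := by
    rw [mul_inv_rev, inv_eq_of_mul_eq_one_left H.z2, H.zc]
  rw [h1, h2, H.chi_z, H.chi_z, neg_sq, H.hrec_neg]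

lemma psi_transport {d : ℕ} (hd : Even d) {g h : G} (s : Equiv.Perm (Fin 7))
    (hs : Equiv.Perm.sign s = 1) (e : s * p h = p g * s) : psi ρ d g = psi ρ d h := by
  obtain ⟨k, h1 | h1⟩ := H.conj_or s hs e
  · rw [h1, H.psi_conj]
  · rw [h1, H.psi_z, H.psi_conj, hd.neg_one_pow, one_mul]

lemma chi_one : chi ρ 1 = 4 := by
  unfold chi
  rw [map_one, LinearMap.trace_one, H.dim]; norm_num

lemma inv_real {g : G} {x : ℝ} (h : chi ρ g = x) : chi ρ g⁻¹ = x := by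
  rw [chi_inv H.dim, h]; simp

lemma psi_1 (d : ℕ) : psi ρ d 1 = hrec 4 6 4 d := by
  unfold psi
  rw [mul_one, inv_one, H.chi_one]; norm_num

lemma psi_2A (d : ℕ) : ∃ g, p g = pa ∧ psi ρ d g = hrec 0 2 0 d := by
  obtain ⟨A, hA⟩ := H.surj pa (by decide)
  refine ⟨A, hA, ?_⟩
  have h1 := H.chi_a hA
  have h2 := H.inv_real (x := 0) (by rw [h1]; simp)
  unfold psi
  rw [h1, h2, H.a_sq hA, ← mul_one z, H.chi_z, H.chi_one]
  norm_num

lemma psi_3A (d : ℕ) : ∃ g, p g = pc ∧ psi ρ d g = hrec (-2) 3 (-2) d := by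
  obtain ⟨C, hC, hC3⟩ := H.lift_odd (a := pc) (n := 3) (by decide) (by decide) (by decide)
  refine ⟨C, hC, ?_⟩
  have h1 := (H.chi_c hC hC3).1
  have h2 := H.inv_real (x := -2) (by rw [h1]; simp)
  unfold psi
  rw [h2, ← pow_two, H.c_inv hC hC3, h1]
  norm_num

lemma psi_3B (d : ℕ) : ∃ g, p g = pc0 * pc1 ∧ psi ρ d g = hrec 1 0 1 d := by
  obtain ⟨C, hC, hC3⟩ := H.lift_odd (a := pc0) (n := 3) (by decide) (by decide) (by decide)
  obtain ⟨D, hD, hD3⟩ := H.lift_odd (a := pc1) (n := 3) (by decide) (by decide) (by decide)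
  have h1 := (H.chi_c' hC hC3 (q7 ![3,4,5,6,0,1,2] ![4,5,6,0,1,2,3]) (by decide) (by decide))
  have h2 := (H.chi_c' hD hD3 (q7 ![0,1,6,2,3,4,5] ![0,1,3,4,5,6,2]) (by decide) (by decide))
  have hcd : C * D = D * C := by
    have : C * D * C⁻¹ = D := by
      apply H.odd_eq (n := 3) (by decide)
      · rw [conj_pow, hD3]; simp
      · exact hD3
      · simp only [map_mul, map_inv, hC, hD]; decide
    exact mul_inv_eq_iff_eq_mul.1 this
  have hcm : Commute C D := hcd
  have o1 : (C * D) ^ 3 = 1 := by rw [hcm.mul_pow, hC3, hD3, one_mul]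
  have o2 : (C ^ 2 * D) ^ 3 = 1 := by
    rw [(hcm.pow_left 2).mul_pow, hD3, ← pow_mul, mul_comm 2 3, pow_mul, hC3, one_pow, one_mul]
  have e1 : chi ρ (C ^ 2 * D) = chi ρ (C * D) :=
    H.chi_odd (n := 3) (by decide) o2 o1 (q7 ![3,4,5,0,2,1,6] ![3,5,4,0,1,2,6]) (by decide)
      (by simp only [map_mul, map_pow, hC, hD]; decide)
  have e2 : chi ρ (C ^ 2 * D) = - chi ρ D - chi ρ (C * D) := by
    unfold chi
    rw [map_mul, map_pow, h1.2, sub_mul, neg_mul, one_mul, map_sub, map_neg, ← map_mul]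
  have e3 : chi ρ (C * D) = 1 := by
    rw [h2.1] at e2
    linear_combination (1/2) * e2 - (1/2) * e1
  have e4 : chi ρ (C * D * (C * D)) = 1 := by
    rw [← e3]
    refine H.chi_odd (n := 3) (by decide) ?_ o1 (q7 ![0,2,1,3,5,4,6] ![0,2,1,3,5,4,6]) (by decide)
      (by simp only [map_mul, hC, hD]; decide)
    rw [← pow_two, ← pow_mul, mul_comm 2 3, pow_mul, o1, one_pow]
  refine ⟨C * D, by rw [map_mul, hC, hD], ?_⟩
  have h2 := H.inv_real (x := 1) (by rw [e3]; simp)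
  unfold psi
  rw [h2, e3, e4]
  norm_num

lemma psi_4A (d : ℕ) : ∃ g, p g = ph * pc0 ∧ psi ρ d g = hrec 0 0 0 d := by
  obtain ⟨C, hC, hC3⟩ := H.lift_odd (a := pc0) (n := 3) (by decide) (by decide) (by decide)
  obtain ⟨D, hD⟩ := H.surj ph (by decide)
  obtain ⟨A, hA⟩ := H.surj pa (by decide)
  have h1 := (H.chi_c' hC hC3 (q7 ![3,4,5,6,0,1,2] ![4,5,6,0,1,2,3]) (by decide) (by decide))
  have e1 : chi ρ D = 0 := H.chi_6 (q7 ![1,3,6,5,0,2,4] ![4,0,5,1,6,3,2]) (by decide)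
    (by rw [hD]; decide)
  have e2 : chi ρ (D * C ^ 2) = 0 := H.chi_6 (q7 ![0,4,6,5,1,2,3] ![0,4,5,6,1,3,2]) (by decide)
    (by simp only [map_mul, map_pow, hC, hD]; decide)
  have e3 : chi ρ (D * C ^ 2) = - chi ρ D - chi ρ (D * C) := by
    unfold chi
    rw [map_mul, map_pow, h1.2, mul_sub, mul_neg, mul_one, map_sub, map_neg, ← map_mul]
  have e4 : chi ρ (D * C) = 0 := by
    rw [e1, e2] at e3; linear_combination e3
  have e5 : chi ρ (D * C * (D * C)) = 0 :=
    H.chi_zero (q7 ![0,1,3,4,2,5,6] ![0,1,4,2,3,5,6]) (by decide)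
      (by simp only [map_mul, hC, hD, hA]; decide) (H.chi_a hA)
  refine ⟨D * C, by rw [map_mul, hC, hD], ?_⟩
  have h2 := H.inv_real (x := 0) (by rw [e4]; simp)
  unfold psi
  rw [h2, e4, e5]
  norm_num

lemma psi_6A (d : ℕ) : ∃ g, p g = pa * pc ∧ psi ρ d g = hrec 0 (-1) 0 d := by
  obtain ⟨C, hC, hC3⟩ := H.lift_odd (a := pc) (n := 3) (by decide) (by decide) (by decide)
  obtain ⟨A, hA⟩ := H.surj pa (by decide)
  have hA2 := H.a_sq hA
  have hcd : A * C = C * A := by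
    have : A * C * A⁻¹ = C := by
      apply H.odd_eq (n := 3) (by decide)
      · rw [conj_pow, hC3]; simp
      · exact hC3
      · simp only [map_mul, map_inv, hC, hA]; decide
    exact mul_inv_eq_iff_eq_mul.1 this
  have e0 : chi ρ (A * C) = 0 := H.chi_6 1 (by decide) (by rw [map_mul, hA, hC]; decide)
  have e1 : A * C * (A * C) = z * C ^ 2 := by
    calc A * C * (A * C) = A * (C * A) * C := by group
      _ = A * (A * C) * C := by rw [hcd]
      _ = (A * A) * C ^ 2 := by rw [pow_two]; group
      _ = _ := by rw [hA2]
  refine ⟨A * C, by rw [map_mul, hA, hC], ?_⟩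
  have h2 := H.inv_real (x := 0) (by rw [e0]; simp)
  unfold psi
  rw [h2, e0, e1, H.chi_z, H.c_inv hC hC3, (H.chi_c hC hC3).1]
  norm_num

lemma psi_5A (d : ℕ) : ∃ g, p g = pf ∧ psi ρ d g = hrec (-1) 1 (-1) d := by
  obtain ⟨C, hC, hC3⟩ := H.lift_odd (a := pf) (n := 5) (by decide) (by decide) (by decide)
  have o : ∀ k, (C ^ k) ^ 5 = 1 := by
    intro k; rw [← pow_mul, mul_comm, pow_mul, hC3, one_pow]
  have e2 : chi ρ (C ^ 2) = chi ρ C := H.chi_odd (n := 5) (by decide) (o 2) hC3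
    (q7 ![0,2,4,1,3,6,5] ![0,3,1,4,2,6,5]) (by decide) (by simp only [map_pow, hC]; decide)
  have e3 : chi ρ (C ^ 3) = chi ρ C := H.chi_odd (n := 5) (by decide) (o 3) hC3
    (q7 ![0,3,1,4,2,6,5] ![0,2,4,1,3,6,5]) (by decide) (by simp only [map_pow, hC]; decide)
  have e4 : chi ρ (C ^ 4) = chi ρ C := H.chi_odd (n := 5) (by decide) (o 4) hC3
    (q7 ![0,4,3,2,1,5,6] ![0,4,3,2,1,5,6]) (by decide) (by simp only [map_pow, hC]; decide)
  have e1 : chi ρ C = -1 := by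
    simp only [chi, map_pow] at e2 e3 e4 ⊢
    exact five_case H.dim (ρ C) (by rw [← map_pow, hC3, map_one]) e2 e3 e4
      (H.rho_ne (by rw [hC]; decide))
  refine ⟨C, hC, ?_⟩
  have h2 := H.inv_real (x := -1) (by rw [e1]; simp)
  unfold psi
  rw [h2, ← pow_two, e2, e1]
  norm_num

lemma psi_7A : ∃ g, ∃ x : ℂ, p g = pe ∧ x ^ 2 = x - 2 ∧ (∀ d, psi ρ d g = hrec x (-1) (1 - x) d) ∧
    (∀ d, psi ρ d g⁻¹ = hrec (1 - x) (-1) x d) := by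
  obtain ⟨C, hC, hC3⟩ := H.lift_odd (a := pe) (n := 7) (by decide) (by decide) (by decide)
  have o : ∀ k, (C ^ k) ^ 7 = 1 := by
    intro k; rw [← pow_mul, mul_comm, pow_mul, hC3, one_pow]
  have e2 : chi ρ (C ^ 2) = chi ρ C := H.chi_odd (n := 7) (by decide) (o 2) hC3
    (q7 ![0,2,4,6,1,3,5] ![0,4,1,5,2,6,3]) (by decide) (by simp only [map_pow, hC]; decide)
  have e4 : chi ρ (C ^ 4) = chi ρ C := H.chi_odd (n := 7) (by decide) (o 4) hC3
    (q7 ![0,4,1,5,2,6,3] ![0,2,4,6,1,3,5]) (by decide) (by simp only [map_pow, hC]; decide)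
  have e6 : chi ρ (C ^ 6) = chi ρ (C ^ 3) := H.chi_odd (n := 7) (by decide) (o 6) (o 3)
    (q7 ![0,2,4,6,1,3,5] ![0,4,1,5,2,6,3]) (by decide) (by simp only [map_pow, hC]; decide)
  have e5 : chi ρ (C ^ 5) = chi ρ (C ^ 3) := H.chi_odd (n := 7) (by decide) (o 5) (o 3)
    (q7 ![0,4,1,5,2,6,3] ![0,2,4,6,1,3,5]) (by decide) (by simp only [map_pow, hC]; decide)
  have hi : C⁻¹ = C ^ 6 := by rw [inv_eq_iff_mul_eq_one, ← pow_succ', hC3]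
  have hii : C⁻¹ * C⁻¹ = C ^ 5 := by
    rw [hi, ← pow_add]
    calc C ^ (6 + 6) = C ^ 7 * C ^ 5 := by group
      _ = _ := by rw [hC3, one_mul]
  have e1 : chi ρ C + chi ρ (C ^ 6) = 1 ∧ chi ρ C ^ 2 = chi ρ C - 2 := by
    simp only [chi, map_pow] at e2 e4 e5 e6 ⊢
    exact seven_case H.dim (ρ C) (by rw [← map_pow, hC3, map_one]) e2 e4 e5 e6
      (H.rho_ne (by rw [hC]; decide))
  have e7 : chi ρ (C ^ 6) = 1 - chi ρ C := by linear_combination e1.1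
  refine ⟨C, chi ρ C, hC, e1.2, fun d => ?_, fun d => ?_⟩
  · unfold psi
    rw [← pow_two, e2, hi, e7, e1.2]
    congr 1; ring
  · unfold psi
    rw [hii, inv_inv, hi, e5, ← e6, e7]
    congr 1
    linear_combination (1/2) * e1.2
end Cov
end Values

section CycleTypes
open Equiv.Perm

lemma ct_list (l : List (Fin 7)) (h : l.Nodup) (hn : 2 ≤ l.length) :
    cycleType l.formPerm = {l.length} := by
  rw [(List.isCycle_formPerm h hn).cycleType, List.support_formPerm_of_nodup l h,
    List.toFinset_card_of_nodup h]
  intro x hx; rw [hx] at hn; simp at hn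

lemma ct_two (l m : List (Fin 7)) (h : l.Nodup) (hn : 2 ≤ l.length) (h' : m.Nodup)
    (hn' : 2 ≤ m.length) (hd : ∀ x, l.formPerm x = x ∨ m.formPerm x = x) :
    cycleType (l.formPerm * m.formPerm) = {l.length, m.length} := by
  rw [Disjoint.cycleType_mul hd, ct_list l h hn, ct_list m h' hn']; rfl

lemma ct_pa : cycleType pa = {2, 2} := by
  have : pa = List.formPerm [0, 1] * List.formPerm [2, 3] := by decide
  rw [this, ct_two _ _ (by decide) (by decide) (by decide) (by decide) (by decide)]; rfl

lemma ct_pc : cycleType pc = {3} := by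
  have : pc = List.formPerm [4, 5, 6] := by decide
  rw [this, ct_list _ (by decide) (by decide)]; rfl

lemma ct_3B : cycleType (pc0 * pc1) = {3, 3} := by
  have : pc0 * pc1 = List.formPerm [0, 1, 2] * List.formPerm [3, 4, 5] := by decide
  rw [this, ct_two _ _ (by decide) (by decide) (by decide) (by decide) (by decide)]; rfl

lemma ct_4A : cycleType (ph * pc0) = {4, 2} := by
  have : ph * pc0 = List.formPerm [0, 3, 1, 2] * List.formPerm [5, 6] ∨
    ph * pc0 = List.formPerm [0, 3, 1, 4] * List.formPerm [5, 6] := by decide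
  rcases this with this | this <;>
  · rw [this, ct_two _ _ (by decide) (by decide) (by decide) (by decide) (by decide)]; rfl

lemma ct_6A : cycleType (pa * pc) = {3, 2, 2} := by
  have : pa * pc = List.formPerm [4, 5, 6] * (List.formPerm [0, 1] * List.formPerm [2, 3]) := by
    decide
  rw [this, Disjoint.cycleType_mul,
    ct_two _ _ (by decide) (by decide) (by decide) (by decide) (by decide),
    ct_list _ (by decide) (by decide)]
  · rfl
  · have : ∀ x : Fin 7, List.formPerm [4, 5, 6] x = x ∨
      (List.formPerm [0, 1] * List.formPerm [2, 3] : Equiv.Perm (Fin 7)) x = x := by decide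
    exact this

lemma ct_pf : cycleType pf = {5} := by
  have : pf = List.formPerm [0, 1, 2, 3, 4] := by decide
  rw [this, ct_list _ (by decide) (by decide)]; rfl

lemma ct_pe : cycleType pe = {7} := by
  have : pe = List.formPerm [0, 1, 2, 3, 4, 5, 6] := by decide
  rw [this, ct_list _ (by decide) (by decide)]; rfl

lemma even_conj {a b o : Equiv.Perm (Fin 7)} (h : cycleType a = cycleType b)
    (ho : sign o = -1) (hc : o * b = b * o) : ∃ s, sign s = 1 ∧ s * b = a * s := by
  obtain ⟨s, hs⟩ := isConj_iff.1 ((isConj_iff_cycleType_eq).2 h.symm)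
  have hs' : s * b = a * s := by rw [← hs]; group
  rcases Int.units_eq_one_or (sign s) with h1 | h1
  · exact ⟨s, h1, hs'⟩
  · refine ⟨s * o, by rw [map_mul, h1, ho]; rfl, ?_⟩
    rw [mul_assoc, hc, ← mul_assoc, hs', mul_assoc]

lemma even_conj7 {a b o : Equiv.Perm (Fin 7)} (h : cycleType a = cycleType b)
    (ho : sign o = -1) (hc : o * b⁻¹ = b * o) :
    (∃ s, sign s = 1 ∧ s * b = a * s) ∨ (∃ s, sign s = 1 ∧ s * b⁻¹ = a * s) := by
  obtain ⟨s, hs⟩ := isConj_iff.1 ((isConj_iff_cycleType_eq).2 h.symm)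
  have hs' : s * b = a * s := by rw [← hs]; group
  rcases Int.units_eq_one_or (sign s) with h1 | h1
  · exact Or.inl ⟨s, h1, hs'⟩
  · refine Or.inr ⟨s * o, by rw [map_mul, h1, ho]; rfl, ?_⟩
    rw [mul_assoc, hc, ← mul_assoc, hs', mul_assoc]

def S7 : Finset (Multiset ℕ) := {0, {2,2}, {3}, {3,3}, {4,2}, {5}, {3,2,2}, {7}}

lemma sum_S7 {M : Type} [AddCommMonoid M] (F : Multiset ℕ → M) : ∑ m ∈ S7, F m =
    F 0 + (F {2,2} + (F {3} + (F {3,3} + (F {4,2} + (F {5} + (F {3,2,2} + F {7})))))) := by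
  unfold S7
  rw [Finset.sum_insert (by decide), Finset.sum_insert (by decide), Finset.sum_insert (by decide),
    Finset.sum_insert (by decide), Finset.sum_insert (by decide), Finset.sum_insert (by decide),
    Finset.sum_insert (by decide), Finset.sum_singleton]

lemma ct_card (m : Multiset ℕ) (n : ℕ)
   (h : (if (m.sum ≤ 7 ∧ ∀ a ∈ m, 2 ≤ a) ∧ Even (m.sum + Multiset.card m) then
        Nat.factorial 7 / (Nat.factorial (7 - m.sum) *
            (m.prod * (∏ n ∈ m.toFinset, Nat.factorial (m.count n)))) else 0) = n) :
    (Finset.univ.filter fun g : alternatingGroup (Fin 7) => cycleType g.1 = m).card = n := by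
  rw [AlternatingGroup.card_of_cycleType, Fintype.card_fin, h]

lemma count_gen {α : Type} [Fintype α] (c : α → Multiset ℕ)
    (h : ∑ m ∈ S7, (Finset.univ.filter fun g => c g = m).card = Fintype.card α) (a : α) :
    c a ∈ S7 := by
  have h1 : (Finset.univ.filter fun g => c g ∈ S7).card = Fintype.card α := by
    rw [← h, Finset.card_eq_sum_card_fiberwise (f := c) (t := S7) (fun x hx => by simpa using hx)]
    refine Finset.sum_congr rfl fun m hm => ?_
    rw [Finset.filter_filter]
    refine congrArg Finset.card (Finset.filter_congr fun g _ => ?_)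
    exact ⟨fun h => h.2, fun h => ⟨h ▸ hm, h⟩⟩
  exact Finset.filter_card_eq (s := Finset.univ) (p := fun g => c g ∈ S7) h1 a (Finset.mem_univ a)

lemma sum_gen {α : Type} [Fintype α] (c : α → Multiset ℕ) (hc : ∀ a, c a ∈ S7)
    (φ : Multiset ℕ → ℂ) :
    ∑ a, φ (c a) = ∑ m ∈ S7, ((Finset.univ.filter fun g => c g = m).card : ℂ) * φ m := by
  rw [← Finset.sum_fiberwise_of_maps_to (t := S7) (g := c) (fun a _ => hc a)]
  refine Finset.sum_congr rfl fun m _ => ?_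
  rw [Finset.sum_congr rfl (g := fun _ => φ m), Finset.sum_const, nsmul_eq_mul]
  intro a ha
  rw [(Finset.mem_filter.1 ha).2]

lemma count_gen' {α : Type} [Fintype α] (c : α → Multiset ℕ) (hn : Fintype.card α = 2520)
    (h0 : (Finset.univ.filter fun g => c g = 0).card = 1)
    (h1 : (Finset.univ.filter fun g => c g = {2,2}).card = 105)
    (h2 : (Finset.univ.filter fun g => c g = {3}).card = 70)
    (h3 : (Finset.univ.filter fun g => c g = {3,3}).card = 280)
    (h4 : (Finset.univ.filter fun g => c g = {4,2}).card = 630)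
    (h5 : (Finset.univ.filter fun g => c g = {5}).card = 504)
    (h6 : (Finset.univ.filter fun g => c g = {3,2,2}).card = 210)
    (h7 : (Finset.univ.filter fun g => c g = {7}).card = 720)
    (a : α) : c a ∈ S7 := by
  refine count_gen c ?_ a
  rw [hn, sum_S7, h0, h1, h2, h3, h4, h5, h6, h7]
  norm_num

lemma sum_gen' {α : Type} [Fintype α] (c : α → Multiset ℕ) (hn : Fintype.card α = 2520)
    (h0 : (Finset.univ.filter fun g => c g = 0).card = 1)
    (h1 : (Finset.univ.filter fun g => c g = {2,2}).card = 105)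
    (h2 : (Finset.univ.filter fun g => c g = {3}).card = 70)
    (h3 : (Finset.univ.filter fun g => c g = {3,3}).card = 280)
    (h4 : (Finset.univ.filter fun g => c g = {4,2}).card = 630)
    (h5 : (Finset.univ.filter fun g => c g = {5}).card = 504)
    (h6 : (Finset.univ.filter fun g => c g = {3,2,2}).card = 210)
    (h7 : (Finset.univ.filter fun g => c g = {7}).card = 720)
    (φ : Multiset ℕ → ℂ) :
    ∑ a, φ (c a) = φ 0 + 105 * φ {2,2} + 70 * φ {3} + 280 * φ {3,3} + 630 * φ {4,2} + 504 * φ {5} +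
    210 * φ {3,2,2} + 720 * φ {7} := by
  rw [sum_gen c (count_gen' c hn h0 h1 h2 h3 h4 h5 h6 h7), sum_S7, h0, h1, h2, h3, h4, h5, h6, h7]
  push_cast
  ring

lemma fact7 : Nat.factorial 7 = 2 * 2520 := by decide

lemma card_a7 : Fintype.card (alternatingGroup (Fin 7)) = 2520 := by
    have h := two_mul_card_alternatingGroup (α := Fin 7)
    rw [Fintype.card_perm, Fintype.card_fin, fact7] at h
    exact Nat.eq_of_mul_eq_mul_left (by norm_num) h

lemma cc0 : (Finset.univ.filter fun g : alternatingGroup (Fin 7) => cycleType g.1 = 0).card = 1 :=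
  ct_card _ _ (by decide)
lemma cc1 : (Finset.univ.filter fun g : alternatingGroup (Fin 7) => cycleType g.1 = {2,2}).card = 105 :=
  ct_card _ _ (by decide)
lemma cc2 : (Finset.univ.filter fun g : alternatingGroup (Fin 7) => cycleType g.1 = {3}).card = 70 :=
  ct_card _ _ (by decide)
lemma cc3 : (Finset.univ.filter fun g : alternatingGroup (Fin 7) => cycleType g.1 = {3,3}).card = 280 :=
  ct_card _ _ (by decide)
lemma cc4 : (Finset.univ.filter fun g : alternatingGroup (Fin 7) => cycleType g.1 = {4,2}).card = 630 :=
  ct_card _ _ (by decide)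
lemma cc5 : (Finset.univ.filter fun g : alternatingGroup (Fin 7) => cycleType g.1 = {5}).card = 504 :=
  ct_card _ _ (by decide)
lemma cc6 : (Finset.univ.filter fun g : alternatingGroup (Fin 7) => cycleType g.1 = {3,2,2}).card = 210 :=
  ct_card _ _ (by decide)
lemma cc7 : (Finset.univ.filter fun g : alternatingGroup (Fin 7) => cycleType g.1 = {7}).card = 720 :=
  ct_card _ _ (by decide)

lemma ct_mem (a : alternatingGroup (Fin 7)) : cycleType a.1 ∈ S7 :=
  count_gen' (fun a : alternatingGroup (Fin 7) => cycleType a.1) card_a7 cc0 cc1 cc2 cc3 cc4 cc5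
    cc6 cc7 a

lemma sum_ct (φ : Multiset ℕ → ℂ) : ∑ a : alternatingGroup (Fin 7), φ (cycleType a.1) =
    φ 0 + 105 * φ {2,2} + 70 * φ {3} + 280 * φ {3,3} + 630 * φ {4,2} + 504 * φ {5} +
    210 * φ {3,2,2} + 720 * φ {7} :=
  sum_gen' (fun a : alternatingGroup (Fin 7) => cycleType a.1) card_a7 cc0 cc1 cc2 cc3 cc4 cc5
    cc6 cc7 φ

end CycleTypes

section Sums
set_option linter.unusedSectionVars false
variable {G : Type} [Group G] [Finite G] {V : Type} [AddCommGroup V] [Module ℂ V] [FiniteDimensional ℂ V]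
open Equiv.Perm

/-- values of `psi g + psi g⁻¹` on cycle types -/
noncomputable def phi (d : ℕ) (x : ℂ) (m : Multiset ℕ) : ℂ :=
  if m = 0 then 2 * hrec 4 6 4 d
  else if m = {2,2} then 2 * hrec 0 2 0 d
  else if m = {3} then 2 * hrec (-2) 3 (-2) d
  else if m = {3,3} then 2 * hrec 1 0 1 d
  else if m = {4,2} then 2 * hrec 0 0 0 d
  else if m = {5} then 2 * hrec (-1) 1 (-1) d
  else if m = {3,2,2} then 2 * hrec 0 (-1) 0 d
  else hrec x (-1) (1 - x) d + hrec (1 - x) (-1) x d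

lemma phi_sum (d : ℕ) (x : ℂ) : ∑ a : alternatingGroup (Fin 7), phi d x (cycleType a.1) =
    2 * (hrec 4 6 4 d + 105 * hrec 0 2 0 d + 70 * hrec (-2) 3 (-2) d + 280 * hrec 1 0 1 d
      + 630 * hrec 0 0 0 d + 504 * hrec (-1) 1 (-1) d + 210 * hrec 0 (-1) 0 d
      + 360 * (hrec x (-1) (1 - x) d + hrec (1 - x) (-1) x d)) := by
  rw [sum_ct]
  have h1 : phi d x 0 = 2 * hrec 4 6 4 d := if_pos rfl
  have h2 : phi d x {2,2} = 2 * hrec 0 2 0 d := by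
    unfold phi; rw [if_neg (by decide), if_pos rfl]
  have h3 : phi d x {3} = 2 * hrec (-2) 3 (-2) d := by
    unfold phi; rw [if_neg (by decide), if_neg (by decide), if_pos rfl]
  have h4 : phi d x {3,3} = 2 * hrec 1 0 1 d := by
    unfold phi; rw [if_neg (by decide), if_neg (by decide), if_neg (by decide), if_pos rfl]
  have h5 : phi d x {4,2} = 2 * hrec 0 0 0 d := by
    unfold phi
    rw [if_neg (by decide), if_neg (by decide), if_neg (by decide), if_neg (by decide), if_pos rfl]
  have h6 : phi d x {5} = 2 * hrec (-1) 1 (-1) d := by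
    unfold phi
    rw [if_neg (by decide), if_neg (by decide), if_neg (by decide), if_neg (by decide),
      if_neg (by decide), if_pos rfl]
  have h7 : phi d x {3,2,2} = 2 * hrec 0 (-1) 0 d := by
    unfold phi
    rw [if_neg (by decide), if_neg (by decide), if_neg (by decide), if_neg (by decide),
      if_neg (by decide), if_neg (by decide), if_pos rfl]
  have h8 : phi d x {7} = hrec x (-1) (1 - x) d + hrec (1 - x) (-1) x d := by
    unfold phi
    rw [if_neg (by decide), if_neg (by decide), if_neg (by decide), if_neg (by decide),
      if_neg (by decide), if_neg (by decide), if_neg (by decide)]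
  rw [h1, h2, h3, h4, h5, h6, h7, h8]
  ring

lemma tot_eval {x : ℂ} (hx : x ^ 2 = x - 2) (d : ℕ) (hd : d = 2 ∨ d = 4 ∨ d = 6 ∨ d = 8) :
    hrec 4 6 4 d + 105 * hrec 0 2 0 d + 70 * hrec (-2) 3 (-2) d + 280 * hrec 1 0 1 d
      + 630 * hrec 0 0 0 d + 504 * hrec (-1) 1 (-1) d + 210 * hrec 0 (-1) 0 d
      + 360 * (hrec x (-1) (1 - x) d + hrec (1 - x) (-1) x d) = if d = 8 then 2520 else 0 := by
  rcases hd with rfl | rfl | rfl | rfl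
  · have : hrec x (-1) (1 - x) 2 + hrec (1 - x) (-1) x 2 = -1 := by
      simp only [hrec]; linear_combination 2 * hx
    rw [this]; simp only [hrec]; norm_num
  · have : hrec x (-1) (1 - x) 4 + hrec (1 - x) (-1) x 4 = 0 := by
      simp only [hrec]; linear_combination (2 - 2 * x + 2 * x ^ 2) * hx
    rw [this]; simp only [hrec]; norm_num
  · have : hrec x (-1) (1 - x) 6 + hrec (1 - x) (-1) x 6 = 0 := by
      simp only [hrec]; linear_combination (4 - 7 * x + 9 * x ^ 2 - 4 * x ^ 3 + 2 * x ^ 4) * hx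
    rw [this]; simp only [hrec]; norm_num
  · have : hrec x (-1) (1 - x) 8 + hrec (1 - x) (-1) x 8 = 1 := by
      simp only [hrec]
      linear_combination (8 - 23 * x + 37 * x ^ 2 - 30 * x ^ 3 + 20 * x ^ 4 - 6 * x ^ 5
        + 2 * x ^ 6) * hx
    rw [this]; simp only [hrec]; norm_num

namespace Cov
variable {p : G →* Equiv.Perm (Fin 7)} {z : G} {ρ : Representation ℂ G V} (H : Cov p z ρ)
include H

lemma psi_class {d : ℕ} (hd : Even d) {a o : Equiv.Perm (Fin 7)} {v : ℂ}
    (hex : ∃ h, p h = a ∧ psi ρ d h = v) (ho : sign o = -1) (hc : o * a = a * o) {m : Multiset ℕ}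
    (ha : cycleType a = m) {g : G} (hg : cycleType (p g) = m) :
    psi ρ d g + psi ρ d g⁻¹ = 2 * v := by
  obtain ⟨h, rfl, rfl⟩ := hex
  have key : ∀ k : G, cycleType (p k) = m → psi ρ d k = psi ρ d h := by
    intro k hk
    obtain ⟨s, hs, e⟩ := even_conj (hk.trans ha.symm) ho hc
    exact H.psi_transport hd s hs e
  rw [key g hg, key g⁻¹ (by rw [map_inv, cycleType_inv, hg])]
  ring

lemma psi_pair {d : ℕ} (hd : Even d) (hp : ∀ g, sign (p g) = 1) :
    ∃ x : ℂ, x ^ 2 = x - 2 ∧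
      ∀ g, psi ρ d g + psi ρ d g⁻¹ = phi d x (cycleType (p g)) := by
  obtain ⟨h, x, hh, hx, h1, h2⟩ := H.psi_7A
  refine ⟨x, hx, fun g => ?_⟩
  unfold phi
  split_ifs with c1 c2 c3 c4 c5 c6 c7
  · exact H.psi_class hd ⟨1, map_one p, H.psi_1 d⟩ (o := Equiv.swap 0 1) (by decide) (by decide)
      cycleType_one c1
  · exact H.psi_class hd (H.psi_2A d) (o := Equiv.swap 4 5) (by decide) (by decide) ct_pa c2
  · exact H.psi_class hd (H.psi_3A d) (o := Equiv.swap 0 1) (by decide) (by decide) ct_pc c3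
  · exact H.psi_class hd (H.psi_3B d) (o := q7 ![3,4,5,0,1,2,6] ![3,4,5,0,1,2,6]) (by decide)
      (by decide) ct_3B c4
  · exact H.psi_class hd (H.psi_4A d) (o := Equiv.swap 5 6) (by decide) (by decide) ct_4A c5
  · exact H.psi_class hd (H.psi_5A d) (o := Equiv.swap 5 6) (by decide) (by decide) ct_pf c6
  · exact H.psi_class hd (H.psi_6A d) (o := Equiv.swap 0 1) (by decide) (by decide) ct_6A c7
  · have c8 : cycleType (p g) = {7} := by
      have := ct_mem ⟨p g, hp g⟩
      simp only [S7, Finset.mem_insert, Finset.mem_singleton] at this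
      tauto
    have key : ∀ (b : G), p b = pe → ∀ k : G, cycleType (p k) = {7} →
        psi ρ d k = psi ρ d b ∨ psi ρ d k = psi ρ d b⁻¹ := by
      intro b hb k hk
      rcases even_conj7 (a := p k) (b := p b) (o := q7 ![0,6,5,4,3,2,1] ![0,6,5,4,3,2,1])
        (by rw [hk, hb, ct_pe]) (by decide) (by rw [hb]; decide) with ⟨s, hs, e⟩ | ⟨s, hs, e⟩
      · exact Or.inl (H.psi_transport hd s hs e)
      · exact Or.inr (H.psi_transport hd s hs (by rw [map_inv]; exact e))
    rcases even_conj7 (a := p g) (b := p h) (o := q7 ![0,6,5,4,3,2,1] ![0,6,5,4,3,2,1])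
        (by rw [c8, hh, ct_pe]) (by decide) (by rw [hh]; decide) with ⟨s, hs, e⟩ | ⟨s, hs, e⟩
    · rw [H.psi_transport hd s hs e, H.psi_transport (g := g⁻¹) (h := h⁻¹) hd s hs, h1, h2]
      rw [map_inv, map_inv, eq_inv_mul_iff_mul_eq, ← mul_assoc, ← e, mul_inv_cancel_right]
    · rw [H.psi_transport (g := g) (h := h⁻¹) hd s hs (by rw [map_inv]; exact e),
        H.psi_transport (g := g⁻¹) (h := h) hd s hs, h1, h2, add_comm]
      rw [map_inv, eq_inv_mul_iff_mul_eq, ← mul_assoc, ← e, inv_mul_cancel_right]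

lemma sum_fib [Fintype G] (hp : ∀ g, sign (p g) = 1) (F : Equiv.Perm (Fin 7) → ℂ) :
    ∑ g, F (p g) = 2 * ∑ a : alternatingGroup (Fin 7), F a.1 := by
  classical
  rw [← Finset.sum_fiberwise_of_maps_to (t := Finset.univ)
    (g := fun g : G => (⟨p g, hp g⟩ : alternatingGroup (Fin 7))) (fun a _ => Finset.mem_univ _),
    Finset.mul_sum]
  refine Finset.sum_congr rfl fun a _ => ?_
  obtain ⟨h, hh⟩ := H.surj a.1 a.2
  have : (Finset.univ.filter fun g : G => (⟨p g, hp g⟩ : alternatingGroup (Fin 7)) = a)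
      = {h, z * h} := by
    ext g
    simp only [Finset.mem_filter, Finset.mem_univ, true_and, Finset.mem_insert,
      Finset.mem_singleton, Subtype.ext_iff]
    constructor
    · intro e; exact H.eq_or (e.trans hh.symm)
    · rintro (e | e)
      · rw [e, hh]
      · rw [e, map_mul, H.pz, one_mul, hh]
  rw [this, Finset.sum_pair, map_mul, H.pz, one_mul, hh]
  · ring
  · intro e
    exact H.z_ne (mul_eq_right.1 e.symm)

lemma sum_psi [Fintype G] (hp : ∀ g, sign (p g) = 1) (d : ℕ)
    (hd : d = 2 ∨ d = 4 ∨ d = 6 ∨ d = 8) :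
    ∑ g, psi ρ d g = if d = 8 then 5040 else 0 := by
  have he : Even d := by rcases hd with rfl | rfl | rfl | rfl <;> decide
  obtain ⟨x, hx, h⟩ := H.psi_pair he hp
  have h1 : ∑ g, psi ρ d g⁻¹ = ∑ g, psi ρ d g := Equiv.sum_comp (Equiv.inv G) (psi ρ d)
  have h2 := Finset.sum_congr (rfl : (Finset.univ : Finset G) = _) (fun g _ => h g)
  rw [Finset.sum_add_distrib, h1, H.sum_fib hp (fun a => phi d x (cycleType a)), phi_sum,
    tot_eval hx d hd] at h2
  have h3 : ∑ g, psi ρ d g = 2 * (if d = 8 then 2520 else 0) := by linear_combination (1/2) * h2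
  rw [h3]
  split_ifs <;> norm_num

lemma card_G (hp : ∀ g, sign (p g) = 1) : (Nat.card G : ℂ) = 5040 := by
  have : Fintype G := Fintype.ofFinite G
  have h := H.sum_fib hp (fun _ => 1)
  simp only [Finset.sum_const, Finset.card_univ, card_a7, nsmul_eq_mul, mul_one] at h
  rw [Nat.card_eq_fintype_card, h]; norm_num

end Cov
end Sums

section Final
set_option linter.unusedSectionVars false
variable {G : Type} [Group G] [Finite G] {V : Type} [AddCommGroup V] [Module ℂ V] [FiniteDimensional ℂ V]

lemma homPoly_comp (T : Module.End ℂ V) (d : ℕ) : homPoly V d ≤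
    (homPoly V d).comap (LinearMap.funLeft ℂ ℂ T) := by
  unfold homPoly
  rw [Submodule.span_le]
  rintro f ⟨φ, rfl⟩
  exact Submodule.subset_span ⟨fun i => (φ i).comp T, rfl⟩

/-- the action on homogeneous polynomial functions -/
noncomputable def polyRep (ρ : Representation ℂ G V) (d : ℕ) : Representation ℂ G (homPoly V d) where
  toFun g := (LinearMap.funLeft ℂ ℂ (ρ g⁻¹)).restrict (homPoly_comp (ρ g⁻¹) d)
  map_one' := by
    ext f v
    simp [LinearMap.restrict_apply, LinearMap.funLeft_apply]
  map_mul' g h := by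
    ext f v
    simp [LinearMap.restrict_apply, LinearMap.funLeft_apply]

lemma polyRep_apply (ρ : Representation ℂ G V) (d : ℕ) (g : G) (f : homPoly V d) (v : V) :
    (polyRep ρ d g f).1 v = f.1 (ρ g⁻¹ v) := rfl

lemma mem_inv_iff (ρ : Representation ℂ G V) (d : ℕ) (f : homPoly V d) :
    f ∈ (polyRep ρ d).invariants ↔ ∀ g : G, (fun v => f.1 (ρ g v)) = f.1 := by
  rw [Representation.mem_invariants]
  constructor
  · intro h g
    have := h g⁻¹
    funext v
    conv_rhs => rw [← this]
    rw [polyRep_apply, inv_inv]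
  · intro h g
    ext v
    rw [polyRep_apply]
    exact congrFun (h g⁻¹) v

lemma det_one (hG : commutator G = ⊤) (ρ : Representation ℂ G V) (g : G) :
    LinearMap.det (ρ g) = 1 := by
  let f : G →* ℂˣ := MonoidHom.toHomUnits ((LinearMap.det : Module.End ℂ V →* ℂ).comp ρ)
  have h := Abelianization.commutator_subset_ker f
  rw [hG] at h
  have h1 : f g = 1 := h (Subgroup.mem_top g)
  exact congrArg Units.val h1

lemma trace_psi (hdim : Module.finrank ℂ V = 4) (hG : commutator G = ⊤)
    (ρ : Representation ℂ G V) (d : ℕ) (g : G) :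
    LinearMap.trace ℂ _ (polyRep ρ d g⁻¹) = psi ρ d g := by
  have hn : Nat.card G ≠ 0 := Nat.card_pos.ne'
  have hg : ρ g ^ (Nat.card G) = 1 := by rw [← map_pow, pow_card_eq_one', map_one]
  obtain ⟨l, h1, hdet, h3, h4⟩ := eigen_data hdim (ρ g) _ hn hg
  have e : g⁻¹ = g ^ (Nat.card G - 1) := by
    rw [inv_eq_iff_mul_eq_one, ← pow_succ', Nat.sub_add_cancel (Nat.one_le_iff_ne_zero.2 hn),
      pow_card_eq_one']
  have hinv : chi ρ g⁻¹ = ∑ i, (l i)⁻¹ := by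
    unfold chi
    rw [e, map_pow, h1]
    refine Finset.sum_congr rfl fun i _ => ?_
    apply eq_inv_of_mul_eq_one_left
    rw [← pow_succ, Nat.sub_add_cancel (Nat.one_le_iff_ne_zero.2 hn), h3]
  have h11 : chi ρ g = ∑ i, l i := by
    have := h1 1
    simp only [pow_one] at this
    exact this
  have h12 : chi ρ (g * g) = ∑ i, l i ^ 2 := by
    unfold chi
    rw [← pow_two, map_pow, h1]
  rw [h4 d _ (fun f v => by rw [polyRep_apply, inv_inv]),
    hsum_eq_hrec l (by rw [← hdet, det_one hG]) d]
  unfold psi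
  rw [h11, h12, hinv]

lemma average_trace {W : Type} [AddCommGroup W] [Module ℂ W] [FiniteDimensional ℂ W] [Fintype G]
    (τ : Representation ℂ G W) (hc : (Fintype.card G : ℂ) = 5040) :
    (5040 : ℂ)⁻¹ * ∑ g, LinearMap.trace ℂ _ (τ g) = Module.finrank ℂ τ.invariants := by
  have : Invertible (Fintype.card G : ℂ) := invertibleOfNonzero (by rw [hc]; norm_num)
  rw [← (Representation.isProj_averageMap τ).trace, ← hc]
  simp [Representation.averageMap, GroupAlgebra.average, _root_.map_sum]

lemma Cov.finrank_inv {p : G →* Equiv.Perm (Fin 7)} {z : G} {ρ : Representation ℂ G V}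
    (H : Cov p z ρ) (hG : commutator G = ⊤) (hp : ∀ g, Equiv.Perm.sign (p g) = 1) (d : ℕ)
    (hd : d = 2 ∨ d = 4 ∨ d = 6 ∨ d = 8) :
    Module.finrank ℂ (polyRep ρ d).invariants = if d = 8 then 1 else 0 := by
  have : Fintype G := Fintype.ofFinite G
  have : FiniteDimensional ℂ (homPoly V d) := homPoly_finite H.dim d
  have hc : (Fintype.card G : ℂ) = 5040 := by rw [← Nat.card_eq_fintype_card, H.card_G hp]
  have h1 := average_trace (polyRep ρ d) hc
  have h3 : ∑ g, LinearMap.trace ℂ _ (polyRep ρ d g) = ∑ g, psi ρ d g := by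
    rw [← Equiv.sum_comp (Equiv.inv G)]
    exact Finset.sum_congr rfl fun g _ => trace_psi H.dim hG ρ d g
  rw [h3, H.sum_psi hp d hd] at h1
  have h4 : ((Module.finrank ℂ (polyRep ρ d).invariants : ℕ) : ℂ) = ((if d = 8 then 1 else 0 : ℕ) : ℂ) := by
    rw [← h1]
    split_ifs <;> norm_num
  exact_mod_cast h4

lemma homPoly_neg (d : ℕ) {f : V → ℂ} (hf : f ∈ homPoly V d) (v : V) :
    f (-v) = (-1) ^ d * f v := by
  unfold homPoly at hf
  induction hf using Submodule.span_induction with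
  | mem x hx =>
    obtain ⟨φ, rfl⟩ := hx
    simp only [map_neg]
    rw [Finset.prod_neg]; simp
  | zero => simp
  | add x y _ _ hx hy => rw [Pi.add_apply, hx, hy, Pi.add_apply]; ring
  | smul a x _ hx => rw [Pi.smul_apply, hx, Pi.smul_apply, smul_eq_mul, smul_eq_mul]; ring

lemma Cov.no_inv {p : G →* Equiv.Perm (Fin 7)} {z : G} {ρ : Representation ℂ G V}
    (H : Cov p z ρ) (hG : commutator G = ⊤) (hp : ∀ g, Equiv.Perm.sign (p g) = 1) (d : ℕ)
    (h1 : 1 ≤ d) (h7 : d ≤ 7) (f : V → ℂ) (hf : f ∈ homPoly V d)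
    (hi : ∀ g : G, (fun v => f (ρ g v)) = f) : f = 0 := by
  rcases Nat.even_or_odd d with he | ho
  · have hd : d = 2 ∨ d = 4 ∨ d = 6 := by
      obtain ⟨k, rfl⟩ := he
      omega
    have : FiniteDimensional ℂ (homPoly V d) := homPoly_finite H.dim d
    have h := H.finrank_inv hG hp d (by tauto)
    rw [if_neg (by omega), Submodule.finrank_eq_zero] at h
    have hm : (⟨f, hf⟩ : homPoly V d) ∈ (polyRep ρ d).invariants := (mem_inv_iff ρ d _).2 hi
    rw [h, Submodule.mem_bot] at hm
    exact congrArg Subtype.val hm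
  · funext v
    have h := congrFun (hi z) v
    simp only [H.hz, LinearMap.neg_apply, Module.End.one_apply] at h
    rw [homPoly_neg d hf, ho.neg_one_pow] at h
    simp only [Pi.zero_apply]
    linear_combination (-1/2) * h

lemma fr_one {W : Type} [AddCommGroup W] [Module ℂ W] (U : Submodule ℂ W)
    (h : Module.finrank ℂ U = 1) : ∃ v ∈ U, v ≠ 0 ∧ ∀ w ∈ U, ∃ c : ℂ, c • v = w := by
  obtain ⟨v, hv, h⟩ := finrank_eq_one_iff'.1 h
  refine ⟨v.1, v.2, fun e => hv (Subtype.ext e), fun w hw => ?_⟩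
  obtain ⟨c, hc⟩ := h ⟨w, hw⟩
  exact ⟨c, congrArg Subtype.val hc⟩

lemma Cov.one_inv {p : G →* Equiv.Perm (Fin 7)} {z : G} {ρ : Representation ℂ G V}
    (H : Cov p z ρ) (hG : commutator G = ⊤) (hp : ∀ g, Equiv.Perm.sign (p g) = 1) :
    ∃ f₀ ∈ homPoly V 8, f₀ ≠ 0 ∧ (∀ g : G, (fun v => f₀ (ρ g v)) = f₀) ∧
      ∀ f ∈ homPoly V 8, (∀ g : G, (fun v => f (ρ g v)) = f) → ∃ c : ℂ, f = c • f₀ := by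
  have h := H.finrank_inv hG hp 8 (by tauto)
  rw [if_pos rfl] at h
  obtain ⟨⟨f₀, h0⟩, hi, hne, h⟩ := fr_one _ h
  refine ⟨f₀, h0, ?_, (mem_inv_iff ρ 8 _).1 hi, ?_⟩
  · rintro rfl; exact hne rfl
  · intro f hf hfi
    obtain ⟨c, hc⟩ := h ⟨f, hf⟩ ((mem_inv_iff ρ 8 _).2 hfi)
    refine ⟨c, ?_⟩
    have := congrArg Subtype.val hc
    exact this.symm

lemma semi_inv (hG : commutator G = ⊤) (ρ : Representation ℂ G V) (f : V → ℂ)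
    (hs : ∀ g : G, ∃ c : ℂ, (fun v => f (ρ g v)) = c • f) (g : G) :
    (fun v => f (ρ g v)) = f := by
  let K : Subgroup G :=
    { carrier := {g | ∀ v, f (ρ g v) = f v}
      one_mem' := by intro v; simp
      mul_mem' := by
        intro a b ha hb v
        rw [map_mul, Module.End.mul_apply, ha, hb]
      inv_mem' := by
        intro a ha v
        have := ha (ρ a⁻¹ v)
        rw [← Module.End.mul_apply, ← map_mul, mul_inv_cancel, map_one, Module.End.one_apply] at this
        exact this.symm }
  have hK : commutator G ≤ K := by
    rw [commutator_def, Subgroup.commutator_le]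
    intro a _ b _
    obtain ⟨ca, ha⟩ := hs a
    obtain ⟨cb, hb⟩ := hs b
    have ha' : ∀ v, f (ρ a v) = ca * f v := fun v => congrFun ha v
    have hb' : ∀ v, f (ρ b v) = cb * f v := fun v => congrFun hb v
    have hcomm : ∀ v, f (ρ (a * b) v) = f (ρ (b * a) v) := by
      intro v
      rw [map_mul, map_mul, Module.End.mul_apply, Module.End.mul_apply, ha', hb', hb', ha']; ring
    intro v
    have := hcomm (ρ (a⁻¹ * b⁻¹) v)
    rw [← Module.End.mul_apply, ← map_mul, ← Module.End.mul_apply, ← map_mul] at this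
    have e : b * a * (a⁻¹ * b⁻¹) = 1 := by group
    rw [e, map_one, Module.End.one_apply, ← mul_assoc] at this
    rw [commutatorElement_def]
    exact this
  rw [hG] at hK
  exact funext (hK (Subgroup.mem_top g))

lemma exists_cov (hG : IsDoubleCoverA7 G) (ρ : Representation ℂ G V)
    (hfaithful : Function.Injective ρ) (hdim : Module.finrank ℂ V = 4)
    (hirr : ∀ W : Submodule ℂ V, (∀ g : G, ∀ v ∈ W, ρ g v ∈ W) → W = ⊥ ∨ W = ⊤) :
    ∃ (p : G →* Equiv.Perm (Fin 7)) (z : G), Cov p z ρ ∧ ∀ g, Equiv.Perm.sign (p g) = 1 := by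
  obtain ⟨-, -, hcard, ⟨e⟩⟩ := hG
  let p : G →* Equiv.Perm (Fin 7) :=
    (alternatingGroup (Fin 7)).subtype.comp (e.toMonoidHom.comp (QuotientGroup.mk' (Subgroup.center G)))
  have hker : ∀ g, p g = 1 ↔ g ∈ Subgroup.center G := by
    intro g
    have : p g = (e (QuotientGroup.mk' _ g)).1 := rfl
    rw [this, ← QuotientGroup.eq_one_iff, ← e.map_eq_one_iff, Subtype.ext_iff]; rfl
  obtain ⟨x, y, hxy, huniv⟩ := Nat.card_eq_two_iff.1 hcard
  obtain ⟨w, hw1, hw⟩ : ∃ w : Subgroup.center G, w ≠ 1 ∧ ∀ u : Subgroup.center G, u = 1 ∨ u = w := by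
    have h1 : ∀ u : Subgroup.center G, u = x ∨ u = y := by
      intro u
      have : u ∈ ({x, y} : Set _) := by rw [huniv]; trivial
      simpa using this
    rcases h1 1 with h | h
    · exact ⟨y, by rw [h]; exact hxy.symm, by rw [h]; exact h1⟩
    · exact ⟨x, by rw [h]; exact hxy, by rw [h]; exact fun u => (h1 u).symm⟩
  have hww : w * w = 1 := by
    rcases hw (w * w) with h | h
    · exact h
    · exact absurd (mul_eq_left.1 h) hw1
  have hz2 : w.1 * w.1 = 1 := congrArg Subtype.val hww
  have hzc : ∀ g, w.1 * g = g * w.1 := fun g => (Subgroup.mem_center_iff.1 w.2 g).symm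
  have hcm : ∀ g v, ρ w.1 (ρ g v) = ρ g (ρ w.1 v) := by
    intro g v
    rw [← Module.End.mul_apply, ← map_mul, hzc, map_mul, Module.End.mul_apply]
  have hsq : ∀ v, ρ w.1 (ρ w.1 v) = v := by
    intro v
    rw [← Module.End.mul_apply, ← map_mul, hz2, map_one, Module.End.one_apply]
  have hρ : ρ w.1 = -1 := by
    rcases hirr (LinearMap.ker (ρ w.1 - 1)) (by
      intro g v hv
      rw [LinearMap.mem_ker, LinearMap.sub_apply, Module.End.one_apply, sub_eq_zero] at hv ⊢
      rw [hcm, hv]) with h | h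
    · ext v
      have : ρ w.1 v + v ∈ LinearMap.ker (ρ w.1 - 1) := by
        rw [LinearMap.mem_ker, LinearMap.sub_apply, Module.End.one_apply, map_add, hsq]
        abel
      rw [h, Submodule.mem_bot] at this
      rw [LinearMap.neg_apply, Module.End.one_apply]
      exact eq_neg_of_add_eq_zero_left this
    · exfalso
      rw [LinearMap.ker_eq_top, sub_eq_zero, ← map_one ρ] at h
      exact hw1 (Subtype.ext (hfaithful h))
  refine ⟨p, w.1, ⟨?_, (hker _).2 w.2, ?_, hρ, hz2, hzc, hfaithful, hdim⟩, fun g => ?_⟩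
  · intro a ha
    obtain ⟨g, hg⟩ := QuotientGroup.mk'_surjective (Subgroup.center G)
      (e.symm ⟨a, Equiv.Perm.mem_alternatingGroup.2 ha⟩)
    refine ⟨g, ?_⟩
    have : p g = (e (QuotientGroup.mk' _ g)).1 := rfl
    rw [this, hg, e.apply_symm_apply]
  · intro g hg
    rcases hw ⟨g, (hker g).1 hg⟩ with h | h
    · exact Or.inl (congrArg Subtype.val h)
    · exact Or.inr (congrArg Subtype.val h)
  · exact Equiv.Perm.mem_alternatingGroup.1 (e (QuotientGroup.mk' _ g)).2

end Final

/-- Let `V` be a faithful irreducible four-dimensional complex representation of the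
quasi-simple group `2.A₇`.  Then there are no nonzero `2.A₇`-invariant homogeneous polynomial
functions on `V` of any degree at most `7`, and the space of invariant homogeneous polynomial
functions of degree `8` is one-dimensional.  In particular, the induced action of `A₇` on
`ℙ³ = ℙ(V)` leaves invariant no surface of degree less than `8`: there is no nonzero
homogeneous polynomial function of degree `1 ≤ d ≤ 7` which is a semi-invariant of `2.A₇`. -/
theorem doubleCoverA7_four_dim_invariants
    (G : Type) [Group G] [Finite G] (hG : IsDoubleCoverA7 G)
    (V : Type) [AddCommGroup V] [Module ℂ V] [FiniteDimensional ℂ V]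
    (ρ : Representation ℂ G V)
    (hfaithful : Function.Injective ρ)
    (hdim : Module.finrank ℂ V = 4)
    (hirr : ∀ W : Submodule ℂ V, (∀ g : G, ∀ v ∈ W, ρ g v ∈ W) → W = ⊥ ∨ W = ⊤) :
    (∀ d : ℕ, 1 ≤ d → d ≤ 7 →
      ∀ f ∈ homPoly V d, (∀ g : G, (fun v => f (ρ g v)) = f) → f = 0) ∧
    (∃ f₀ ∈ homPoly V 8, f₀ ≠ 0 ∧ (∀ g : G, (fun v => f₀ (ρ g v)) = f₀) ∧
      ∀ f ∈ homPoly V 8, (∀ g : G, (fun v => f (ρ g v)) = f) → ∃ c : ℂ, f = c • f₀) ∧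
    (∀ d : ℕ, 1 ≤ d → d ≤ 7 →
      ∀ f ∈ homPoly V d, (∀ g : G, ∃ c : ℂ, (fun v => f (ρ g v)) = c • f) → f = 0) := by
  obtain ⟨p, z, H, hp⟩ := exists_cov hG ρ hfaithful hdim hirr
  exact ⟨fun d h1 h7 f hf hi => H.no_inv hG.1 hp d h1 h7 f hf hi, H.one_inv hG.1 hp,
    fun d h1 h7 f hf hs => H.no_inv hG.1 hp d h1 h7 f hf (semi_inv hG.1 ρ f hs)⟩
end

section
/- Let V be a faithful irreducible four-dimensional complex representation of the quasi-simple group 2.A7, with quotient map ν : 2.A7 → A7. For every proper subgroup H ⊆ A7 of index at most 42 (so H is isomorphic to one of A6, PSL2(F7), S5, (A4 × ℤ/3ℤ) ⋊ ℤ/2ℤ, or A5), the restriction of V to the preimage ν⁻¹(H) contains no one-dimensional subrepresentation. In particular, the restriction of V to a subgroup 2.A6 = ν⁻¹(A6) is irreducible, and the induced action of A7 on ℙ³ = ℙ(V) has no orbit of size at most 56. -/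
namespace DC
open Subgroup

theorem card_cent (σ : Equiv.Perm (Fin 7)) (p c : ℕ) (hp : p.Prime) (h4 : 4 ≤ p) (hσ : orderOf σ = p)
    (hc : (7 - p).factorial * p = c) :
    Nat.card (centralizer {σ}) = c := by
  obtain ⟨n, hn⟩ := Equiv.Perm.cycleType_prime_order (σ := σ) (hσ ▸ hp)
  rw [hσ] at hn
  have hs : σ.cycleType.sum ≤ 7 := by
    rw [Equiv.Perm.sum_cycleType]
    exact (Finset.card_le_univ _).trans (by simp)
  rw [hn] at hs
  simp only [Multiset.sum_replicate, smul_eq_mul] at hs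
  have hn0 : n = 0 := by nlinarith
  subst hn0
  rw [Equiv.Perm.nat_card_centralizer, hn]
  simp [hc]

theorem card_normalizer_dvd {K : Type*} [Group K] [Finite K] (f : K →* Equiv.Perm (Fin 7))
    (hf : Function.Injective f) (p c : ℕ) [hp : Fact p.Prime] (h4 : 4 ≤ p)
    (hc : (7 - p).factorial * p = c) (P : Subgroup K) (hP : Nat.card P = p) :
    Nat.card (normalizer (P : Set K)) ∣ (p - 1) * c := by
  have hcyc : IsCyclic P := isCyclic_of_prime_card hP
  obtain ⟨x, hx⟩ := hcyc.exists_generator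
  have hxo : orderOf x = p := by
    rw [orderOf_eq_card_of_forall_mem_zpowers hx, hP]
  have hfx : orderOf (f x) = p := by
    rw [orderOf_injective f hf, ← hxo]; simp
  have hC : Nat.card (centralizer (P : Set K)) ∣ c := by
    rw [← card_cent (f x) p c hp.out h4 hfx hc]
    let φ : centralizer (P : Set K) →* centralizer ({f x} : Set (Equiv.Perm (Fin 7))) :=
      (f.comp (centralizer (P : Set K)).subtype).codRestrict _ (by
        intro y
        rw [mem_centralizer_iff]
        rintro _ rfl
        have := mem_centralizer_iff.1 y.2 x x.2
        simp only [MonoidHom.comp_apply, subtype_apply, ← map_mul]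
        exact congrArg f this)
    refine card_dvd_of_injective φ ?_
    intro a b hab
    have : f a = f b := congrArg Subtype.val hab
    exact Subtype.ext (hf this)
  have h1 := (P.normalizerMonoidHom).ker.card_mul_index
  rw [← h1, index_ker, mul_comm]
  refine mul_dvd_mul ?_ ?_
  · have : Nat.card (MulAut P) = p - 1 := by
      rw [IsCyclic.card_mulAut, hP, Nat.totient_prime hp.out]
    rw [← this]
    exact card_subgroup_dvd_card _
  · refine dvd_trans ?_ hC
    rw [normalizerMonoidHom_ker]
    exact card_comap_dvd_of_injective _ _ (subtype_injective _)

theorem card_dvd_5040 {K : Type*} [Group K] [Finite K] (f : K →* Equiv.Perm (Fin 7))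
    (hf : Function.Injective f) : Nat.card K ∣ 5040 := by
  have := card_dvd_of_injective f hf
  rwa [Nat.card_eq_fintype_card (α := Equiv.Perm (Fin 7)), Fintype.card_perm, Fintype.card_fin,
    show Nat.factorial 7 = 5040 from rfl] at this

theorem sylow_card {K : Type*} [Group K] [Finite K] (f : K →* Equiv.Perm (Fin 7))
    (hf : Function.Injective f) (p : ℕ) [hp : Fact p.Prime] (hpd : ¬ p * p ∣ 5040)
    (hd : p ∣ Nat.card K) (P : Sylow p K) : Nat.card P = p := by
  obtain ⟨n, hn⟩ := IsPGroup.iff_card.mp P.isPGroup'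
  have h1 : p ∣ Nat.card P := P.dvd_card_of_dvd_card hd
  have h2 : Nat.card P ∣ 5040 := (card_subgroup_dvd_card _).trans (card_dvd_5040 f hf)
  rcases n with _ | _ | n
  · rw [hn] at h1; simp at h1; exact absurd h1 hp.out.one_lt.ne'
  · rw [hn]; simp
  · exfalso; apply hpd; refine dvd_trans ?_ h2
    rw [hn]; exact ⟨p ^ n, by ring⟩

theorem odd_five {K : Type*} [Group K] [Finite K] (f : K →* Equiv.Perm (Fin 7))
    (hf : Function.Injective f) (hodd : ¬ 2 ∣ Nat.card K) (hd : 5 ∣ Nat.card K) :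
    ∃ n, Nat.card K = 5 * n ∧ n % 5 = 1 := by
  have : Fact (Nat.Prime 5) := ⟨by norm_num⟩
  let P : Sylow 5 K := default
  have hP := sylow_card f hf 5 (by norm_num) hd P
  have h1 := card_normalizer_dvd f hf 5 10 (by norm_num) rfl P hP
  have h2 : 5 ∣ Nat.card (normalizer (P : Set K)) := by
    conv_lhs => rw [← hP]
    exact card_dvd_of_le le_normalizer
  have h3 : Nat.card (normalizer (P : Set K)) ∣ Nat.card K := card_subgroup_dvd_card _
  have h4 := card_sylow_modEq_one 5 K
  rw [P.card_eq_index_normalizer] at h4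
  have h5 := (normalizer (P : Set K)).card_mul_index
  have h6 : Nat.card (normalizer (P : Set K)) = 5 := by
    have h7 : ¬ 2 ∣ Nat.card (normalizer (P : Set K)) := fun h => hodd (h.trans h3)
    generalize Nat.card (normalizer (P : Set K)) = m at *
    have : m ≤ 40 := Nat.le_of_dvd (by norm_num) h1
    interval_cases m <;> simp_all
  rw [h6] at h5
  exact ⟨_, h5.symm, h4⟩

theorem no_105 {K : Type*} [Group K] [Finite K] (f : K →* Equiv.Perm (Fin 7))
    (hf : Function.Injective f) : Nat.card K ≠ 105 := by
  intro hK
  have : Fact (Nat.Prime 3) := ⟨by norm_num⟩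
  let P : Sylow 3 K := default
  have hP : Nat.card P = 3 := by
    obtain ⟨n, hn⟩ := IsPGroup.iff_card.mp P.isPGroup'
    have h1 : 3 ∣ Nat.card P := P.dvd_card_of_dvd_card (by rw [hK]; norm_num)
    have h2 : Nat.card P ∣ 105 := hK ▸ card_subgroup_dvd_card _
    rcases n with _ | _ | n
    · rw [hn] at h1; norm_num at h1
    · rw [hn]; simp
    · exfalso
      have : 9 ∣ 105 := dvd_trans ⟨3 ^ n, by rw [hn]; ring⟩ h2
      norm_num at this
  have hcyc : IsCyclic P := isCyclic_of_prime_card hP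
  have hmin : (Nat.card K).minFac = 3 := by rw [hK]; norm_num
  have hcomp := IsCyclic.isComplement' hmin hcyc
  have := hcomp.card_mul_card
  rw [hK] at this
  have h35 : Nat.card (MonoidHom.transferSylow P (IsCyclic.normalizer_le_centralizer hmin hcyc)).ker = 35 := by
    have h3 : Nat.card (P : Subgroup K) = 3 := hP
    rw [h3] at this; omega
  obtain ⟨n, h1, h2⟩ := odd_five (f.comp (Subgroup.subtype (MonoidHom.transferSylow P (IsCyclic.normalizer_le_centralizer hmin hcyc)).ker))
    (hf.comp (subtype_injective _)) (by rw [h35]; norm_num) (by rw [h35]; norm_num)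
  omega

theorem card_le_of_cyclic {K : Type*} [Group K] [Finite K] (f : K →* Equiv.Perm (Fin 7))
    (hf : Function.Injective f) (P : Sylow 2 K) (hc : IsCyclic P) (h4 : Nat.card P ∣ 4) :
    Nat.card K < 45 := by
  by_contra! h45
  have : Fact (Nat.Prime 2) := ⟨by norm_num⟩
  have : Fact (Nat.Prime 7) := ⟨by norm_num⟩
  -- normal odd complement
  obtain ⟨N, hN, hodd, hcard⟩ : ∃ N : Subgroup K, N.Normal ∧ ¬ 2 ∣ Nat.card N ∧
      Nat.card N * Nat.card P = Nat.card K := by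
    by_cases h2 : 2 ∣ Nat.card K
    · have hmin : (Nat.card K).minFac = 2 := by
        rw [Nat.minFac_eq_two_iff]; exact h2
      exact ⟨_, inferInstance, MonoidHom.not_dvd_card_ker_transferSylow P
        (IsCyclic.normalizer_le_centralizer hmin hc), (IsCyclic.isComplement' hmin hc).card_mul_card⟩
    · refine ⟨⊤, inferInstance, by simpa using h2, ?_⟩
      have : Nat.card P = 1 := by
        have h1 : Nat.card P ∣ Nat.card K := card_subgroup_dvd_card _
        have h5 : ¬ 2 ∣ Nat.card P := fun h => h2 (h.trans h1)
        have : Nat.card P ≤ 4 := Nat.le_of_dvd (by norm_num) h4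
        generalize Nat.card P = m at *
        interval_cases m <;> simp_all
      rw [this]; simp
  have hP4 : Nat.card P ≤ 4 := Nat.le_of_dvd (by norm_num) h4
  have hfN : Function.Injective (f.comp N.subtype) := hf.comp (subtype_injective _)
  have hN12 : 12 ≤ Nat.card N := by nlinarith
  have hN315 : Nat.card N ∣ 315 := by
    have h1 := card_dvd_5040 _ hfN
    have : (Nat.card N).Coprime 16 := by
      rw [show 16 = 2 ^ 4 by norm_num]
      exact Nat.Coprime.pow_right _ (((Nat.Prime.coprime_iff_not_dvd Nat.prime_two).2 hodd).symm)
    exact this.dvd_of_dvd_mul_left (by simpa using h1)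
  have h5 : ¬ 5 ∣ Nat.card N := by
    intro h
    obtain ⟨n, h1, h2⟩ := odd_five _ hfN hodd h
    have h105 := no_105 _ hfN
    have : n ∣ 63 := by
      rw [h1] at hN315; exact Nat.dvd_of_mul_dvd_mul_left (k := 5) (by norm_num) hN315
    have : n ≤ 63 := Nat.le_of_dvd (by norm_num) this
    interval_cases n <;> omega
  have h7 : 7 ∣ Nat.card N := by
    have : Nat.card N ≤ 315 := Nat.le_of_dvd (by norm_num) hN315
    generalize Nat.card N = m at *
    have : m ∈ Nat.divisors 315 := by simp [hN315]
    have h : Nat.divisors 315 = {1,3,5,7,9,15,21,35,45,63,105,315} := by decide +kernel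
    rw [h] at this
    simp at this
    omega
  let Q : Sylow 7 N := default
  have hQ := sylow_card _ hfN 7 (by norm_num) h7 Q
  have hQ1 : Nat.card (Sylow 7 N) = 1 := by
    have h1 := card_sylow_modEq_one 7 N
    have h2 := Q.card_dvd_index
    have h3 := (Q : Subgroup N).card_mul_index
    have hQ' : Nat.card (Q : Subgroup N) = 7 := hQ
    rw [hQ'] at h3
    have h9 : (Q : Subgroup N).index ∣ 9 := by
      have h45 : (Q : Subgroup N).index ∣ 45 := by
        rw [← h3] at hN315; exact Nat.dvd_of_mul_dvd_mul_left (k := 7) (by norm_num) hN315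
      have : (Q : Subgroup N).index ∈ Nat.divisors 45 := by simp [h45]
      have h : Nat.divisors 45 = {1,3,5,9,15,45} := by decide +kernel
      rw [h] at this
      simp at this
      have h5' : ¬ 5 ∣ (Q : Subgroup N).index := fun h => h5 (h3 ▸ h.mul_left 7)
      rcases this with h | h | h | h | h | h <;> simp_all
    have h10 := h2.trans h9
    have : Nat.card (Sylow 7 N) ≤ 9 := Nat.le_of_dvd (by norm_num) h10
    generalize Nat.card (Sylow 7 N) = m at *
    change m % 7 = 1 % 7 at h1
    interval_cases m <;> simp_all
  have : Subsingleton (Sylow 7 N) := (Nat.card_eq_one_iff_unique.1 hQ1).1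
  have hch : (Q : Subgroup N).Characteristic := Sylow.characteristic_of_subsingleton Q
  have hnor : ((Q : Subgroup N).map N.subtype).Normal := inferInstance
  have hc7 : Nat.card ((Q : Subgroup N).map N.subtype) = 7 := by
    rw [card_map_of_injective (subtype_injective _)]; exact hQ
  have := card_normalizer_dvd f hf 7 7 (by norm_num) rfl _ hc7
  rw [normalizer_eq_top, card_top] at this
  have := Nat.le_of_dvd (by norm_num) this
  omega
end DC

namespace DC
open Subgroup

abbrev A7 := alternatingGroup (Fin 7)

def ea : A7 := ⟨Equiv.swap 0 1 * Equiv.swap 1 2 * Equiv.swap 2 3 * Equiv.swap 4 5, by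
  rw [Equiv.Perm.mem_alternatingGroup]; decide +kernel⟩
def eb : A7 := ⟨Equiv.swap 0 2 * Equiv.swap 4 5, by
  rw [Equiv.Perm.mem_alternatingGroup]; decide +kernel⟩

theorem ed_mul : ∀ i : Fin 4, ∀ j : Fin 2, ∀ k : Fin 4, ∀ l : Fin 2, ∃ m : Fin 4, ∃ n : Fin 2,
    (ea ^ (i : ℕ) * eb ^ (j : ℕ)) * (ea ^ (k : ℕ) * eb ^ (l : ℕ)) = ea ^ (m : ℕ) * eb ^ (n : ℕ) := by
  decide +kernel

theorem ed_inv : ∀ i : Fin 4, ∀ j : Fin 2, ∃ m : Fin 4, ∃ n : Fin 2,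
    (ea ^ (i : ℕ) * eb ^ (j : ℕ))⁻¹ = ea ^ (m : ℕ) * eb ^ (n : ℕ) := by
  decide +kernel

theorem ed_inj : ∀ x y : Fin 4 × Fin 2,
    ea ^ (x.1 : ℕ) * eb ^ (x.2 : ℕ) = ea ^ (y.1 : ℕ) * eb ^ (y.2 : ℕ) → x = y := by
  decide +kernel

theorem ed_refl : ∀ i k : Fin 4, ∀ j : Fin 2,
    ea ^ (k : ℕ) * eb ^ (j : ℕ) = 1 ∨ ea ^ (k : ℕ) * eb ^ (j : ℕ) = ea ^ (i : ℕ) * eb ∨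
    ea ^ (k : ℕ) * eb ^ (j : ℕ) = ea ^ 2 ∨
    (ea ^ (k : ℕ) * eb ^ (j : ℕ)) * (ea ^ (k : ℕ) * eb ^ (j : ℕ)) = ea ^ 2 ∨
    (ea ^ (k : ℕ) * eb ^ (j : ℕ)) * (ea ^ (i : ℕ) * eb) = ea ^ 2 ∨
    ((ea ^ (k : ℕ) * eb ^ (j : ℕ)) * (ea ^ (i : ℕ) * eb)) *
      ((ea ^ (k : ℕ) * eb ^ (j : ℕ)) * (ea ^ (i : ℕ) * eb)) = ea ^ 2 := by
  decide +kernel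

theorem ed_refl_sq : ∀ i : Fin 4, (ea ^ (i : ℕ) * eb) ^ 2 = 1 := by decide +kernel

theorem ed_comm : ∀ i : Fin 4, ea ^ 2 * (ea ^ (i : ℕ) * eb) = (ea ^ (i : ℕ) * eb) * ea ^ 2 := by
  decide +kernel

theorem ea_four : ea ^ 4 = 1 := by decide +kernel
theorem ea_sq : ea ^ 2 ≠ 1 := by decide +kernel
theorem ed_commutator : ea * eb * ea⁻¹ * eb⁻¹ = ea ^ 2 := by decide +kernel

def D0 : Subgroup A7 where
  carrier := Set.range (fun x : Fin 4 × Fin 2 => ea ^ (x.1 : ℕ) * eb ^ (x.2 : ℕ))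
  mul_mem' := by
    rintro _ _ ⟨⟨i, j⟩, rfl⟩ ⟨⟨k, l⟩, rfl⟩
    obtain ⟨m, n, h⟩ := ed_mul i j k l
    exact ⟨(m, n), h.symm⟩
  one_mem' := ⟨(0, 0), by simp⟩
  inv_mem' := by
    rintro _ ⟨⟨i, j⟩, rfl⟩
    obtain ⟨m, n, h⟩ := ed_inv i j
    exact ⟨(m, n), h.symm⟩

theorem mem_D0 {x : A7} (h : x ∈ D0) : ∃ i : Fin 4, ∃ j : Fin 2, x = ea ^ (i : ℕ) * eb ^ (j : ℕ) := by
  obtain ⟨⟨i, j⟩, rfl⟩ := h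
  exact ⟨i, j, rfl⟩

theorem card_D0 : Nat.card D0 = 8 := by
  change Nat.card (Set.range (fun x : Fin 4 × Fin 2 => ea ^ (x.1 : ℕ) * eb ^ (x.2 : ℕ))) = 8
  rw [Nat.card_range_of_injective (fun x y h => ed_inj x y h)]
  simp

theorem card_A7 : Nat.card A7 = 2520 := by
  have := two_mul_nat_card_alternatingGroup (α := Fin 7)
  rw [Nat.card_eq_fintype_card (α := Equiv.Perm (Fin 7)), Fintype.card_perm, Fintype.card_fin,
    show Nat.factorial 7 = 5040 from rfl] at this
  change 2 * Nat.card A7 = 5040 at this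
  omega

/-- The data of a double cover used in the proof. -/
structure Cov (G : Type) [Group G] (ν : G →* A7) (z : G) : Prop where
  surj : Function.Surjective ν
  perf : commutator G = ⊤
  ker : ∀ g, ν g = 1 → g = 1 ∨ g = z
  nz : ν z = 1
  cen : ∀ g, z * g = g * z
  sq : z * z = 1
  ne : z ≠ 1

theorem Cov.lift {G : Type} [Group G] {ν : G →* A7} {z : G} (C : Cov G ν z) {g h : G}
    (e : ν g = ν h) : g = h ∨ g = z * h := by
  have : ν (g * h⁻¹) = 1 := by simp [e]
  rcases C.ker _ this with h1 | h1
  · left; exact mul_inv_eq_one.1 h1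
  · right; exact mul_inv_eq_iff_eq_mul.1 h1

theorem Cov.card_ker {G : Type} [Group G] {ν : G →* A7} {z : G} (C : Cov G ν z) :
    Nat.card ν.ker = 2 := by
  have : (ν.ker : Set G) = {1, z} := by
    ext g
    simp only [SetLike.mem_coe, MonoidHom.mem_ker, Set.mem_insert_iff, Set.mem_singleton_iff]
    constructor
    · exact C.ker g
    · rintro (rfl | rfl)
      · simp
      · exact C.nz
  change Nat.card (ν.ker : Set G) = 2
  rw [this, Nat.card_coe_set_eq]
  exact Set.ncard_pair C.ne.symm

theorem Cov.transfer {G : Type} [Group G] [Finite G] {ν : G →* A7} {z : G} (C : Cov G ν z) :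
    z ∈ ⁅comap ν D0, comap ν D0⁆ := by
  set S := comap ν D0 with hS
  have hzS : z ∈ S := by
    rw [hS, mem_comap, C.nz]; exact one_mem _
  have hidx : S.index = 315 := by
    rw [hS, index_comap_of_surjective _ C.surj]
    have := D0.card_mul_index
    rw [card_D0, card_A7] at this
    omega
  have hpow : z ^ S.index = z := by
    rw [hidx, show 315 = 2 * 157 + 1 by norm_num, pow_succ, pow_mul, pow_two, C.sq]; simp
  have key : ∀ (k : ℕ) (g₀ : G), g₀⁻¹ * z ^ k * g₀ ∈ S → g₀⁻¹ * z ^ k * g₀ = z ^ k := by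
    intro k g₀ _
    have : z ^ k * g₀ = g₀ * z ^ k := ((show Commute z g₀ from C.cen g₀).pow_left k).eq
    rw [mul_assoc, this, inv_mul_cancel_left]
  have h1 := MonoidHom.transfer_eq_pow (Abelianization.of : S →* Abelianization S) z key
  have h2 : MonoidHom.transfer (Abelianization.of : S →* Abelianization S) z = 1 := by
    have := Abelianization.commutator_subset_ker (MonoidHom.transfer (Abelianization.of : S →* Abelianization S))
    rw [C.perf] at this
    exact this (mem_top z)
  rw [h2] at h1
  have h3 : (⟨z ^ S.index, MonoidHom.transfer_eq_pow_aux z key⟩ : S) ∈ commutator S := by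
    rw [← Abelianization.ker_of]
    exact h1.symm
  have h4 := mem_map_of_mem S.subtype h3
  rw [commutator_def, map_commutator] at h4
  simpa [hpow, ← MonoidHom.range_eq_map] using h4

theorem Cov.noncomm {G : Type} [Group G] [Finite G] {ν : G →* A7} {z : G} (C : Cov G ν z)
    (A B : G) (hA : ν A = ea) (hB : ν B = eb) : A ^ 2 * B ≠ B * A ^ 2 := by
  intro hAB
  obtain ⟨w, hw⟩ : ∃ w, w = A * B * A⁻¹ * B⁻¹ := ⟨_, rfl⟩
  have hνw : ν w = ea ^ 2 := by simp [hw, hA, hB, ed_commutator]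
  have hwA2 : w = A ^ 2 ∨ w = z * A ^ 2 := C.lift (by rw [hνw, map_pow, hA])
  have cz : ∀ g, Commute z g := C.cen
  have cAB : Commute (A ^ 2) B := hAB
  have cwA : Commute w A := by
    rcases hwA2 with h | h <;> rw [h]
    · exact (Commute.refl A).pow_left 2
    · exact (cz A).mul_left ((Commute.refl A).pow_left 2)
  have cwB : Commute w B := by
    rcases hwA2 with h | h <;> rw [h]
    · exact cAB
    · exact (cz B).mul_left cAB
  have hABw : A * B = w * (B * A) := by rw [hw]; group
  have hw2 : w * w = 1 := by
    have h1 : A * (A * B) = w * w * (B * (A * A)) := by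
      calc A * (A * B) = A * (w * (B * A)) := by rw [hABw]
        _ = w * ((A * B) * A) := by rw [← mul_assoc, ← cwA.eq]; simp only [mul_assoc]
        _ = _ := by rw [hABw]; simp only [mul_assoc]
    have h2 : A * (A * B) = B * (A * A) := by rw [← mul_assoc, ← pow_two, hAB]
    rw [h2] at h1
    exact (mul_eq_right.1 h1.symm)
  let M (x : G) (hx : Commute w x): Submonoid G :=
    { carrier := {h | Commute w h ∧ (x * h = h * x ∨ x * h = w * (h * x))}
      one_mem' := ⟨Commute.one_right w, Or.inl (by simp)⟩
      mul_mem' := by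
        rintro g h ⟨g1, g2⟩ ⟨h1, h2⟩
        refine ⟨g1.mul_right h1, ?_⟩
        have e1 : x * (g * h) = (x * g) * h := (mul_assoc _ _ _).symm
        rcases g2 with g2 | g2 <;> rcases h2 with h2 | h2
        · left; rw [e1, g2, mul_assoc, h2, mul_assoc]
        · right; rw [e1, g2, mul_assoc, h2, ← mul_assoc, ← g1.eq]; simp only [mul_assoc]
        · right; rw [e1, g2]; simp only [mul_assoc]; rw [h2]
        · left; rw [e1, g2]; simp only [mul_assoc]; rw [h2, ← mul_assoc g, ← g1.eq, mul_assoc,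
            ← mul_assoc w, hw2, one_mul] }
  have hgen : ∀ (N : Submonoid G), A ∈ N → B ∈ N → z ∈ N → ∀ g ∈ comap ν D0, g ∈ N := by
    intro N h1 h2 h3 g hg
    obtain ⟨i, j, hij⟩ := mem_D0 (mem_comap.1 hg)
    have : ν g = ν (A ^ (i : ℕ) * B ^ (j : ℕ)) := by rw [hij]; simp [hA, hB]
    have h4 := N.mul_mem (N.pow_mem h1 (i : ℕ)) (N.pow_mem h2 (j : ℕ))
    rcases C.lift this with h | h <;> rw [h]
    · exact h4
    · exact N.mul_mem h3 h4
  have symm : ∀ x g : G, (x * g = g * x ∨ x * g = w * (g * x)) →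
      (g * x = x * g ∨ g * x = w * (x * g)) := by
    rintro x g (h | h)
    · left; exact h.symm
    · right; rw [h, ← mul_assoc, hw2, one_mul]
  have hwz : Commute w z := (cz w).symm
  have hMA := hgen (M A cwA) ⟨cwA, Or.inl rfl⟩ ⟨cwB, Or.inr hABw⟩ ⟨hwz, Or.inl (cz A).symm.eq⟩
  have hMB := hgen (M B cwB) ⟨cwA, symm _ _ (Or.inr hABw)⟩ ⟨cwB, Or.inl rfl⟩
    ⟨hwz, Or.inl (cz B).symm.eq⟩
  have hall : ∀ g ∈ comap ν D0, ∀ h ∈ comap ν D0, g * h = h * g ∨ g * h = w * (h * g) := by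
    intro g hg h hh
    have hc : Commute w g := (hMA g hg).1
    exact (hgen (M g hc) ⟨cwA, symm _ _ (hMA g hg).2⟩ ⟨cwB, symm _ _ (hMB g hg).2⟩
      ⟨hwz, Or.inl (cz g).symm.eq⟩ h hh).2
  let K : Subgroup G :=
    { carrier := {1, w}
      one_mem' := by simp
      mul_mem' := by
        rintro x y (rfl | rfl) (rfl | rfl) <;> simp [hw2]
      inv_mem' := by
        rintro x (rfl | rfl)
        · simp
        · right; exact inv_eq_of_mul_eq_one_left hw2 }
  have hle : ⁅comap ν D0, comap ν D0⁆ ≤ K := by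
    rw [commutator_le]
    intro g hg h hh
    rw [commutatorElement_def]
    rcases hall g hg h hh with e | e <;> rw [e]
    · left; group
    · right; change _ = w; group
  rcases hle C.transfer with h | h
  · exact C.ne h
  · have := C.nz
    rw [show z = w from h, hνw] at this
    exact ea_sq this

theorem Cov.klein {G : Type} [Group G] [Finite G] {ν : G →* A7} {z : G} (C : Cov G ν z)
    (g : A7) (i : Fin 4) (p q : G) (hp : ν p = g * ea ^ 2 * g⁻¹)
    (hq : ν q = g * (ea ^ (i : ℕ) * eb) * g⁻¹) : p * q = z * (q * p) := by
  have hpq : ν (p * q) = ν (q * p) := by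
    rw [map_mul, map_mul, hp, hq]
    have := ed_comm i
    calc _ = g * (ea ^ 2 * (ea ^ (i : ℕ) * eb)) * g⁻¹ := by group
      _ = _ := by rw [this]; group
  rcases C.lift hpq with h | h
  · exfalso
    obtain ⟨γ, rfl⟩ := C.surj g
    obtain ⟨A, hA⟩ := C.surj ea
    obtain ⟨B, hB⟩ := C.surj eb
    have cz : ∀ g, Commute z g := C.cen
    have hc : Commute (γ⁻¹ * p * γ) (γ⁻¹ * q * γ) := by
      have : Commute p q := h
      have h2 := (Commute.conj_iff (γ⁻¹)).2 this
      simpa using h2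
    have h1 : Commute (A ^ 2) (γ⁻¹ * q * γ) := by
      rcases C.lift (g := A ^ 2) (h := γ⁻¹ * p * γ) (by simp [hp, hA, mul_assoc]) with e | e <;> rw [e]
      · exact hc
      · exact (cz _).mul_left hc
    have h2 : Commute (A ^ 2) (A ^ (i : ℕ) * B) := by
      rcases C.lift (g := A ^ (i : ℕ) * B) (h := γ⁻¹ * q * γ)
        (by simp [hq, hA, hB, mul_assoc]) with e | e <;> rw [e]
      · exact h1
      · exact (cz _).symm.mul_right h1
    have h3 : Commute (A ^ 2) B := by
      have : Commute (A ^ 2) ((A ^ (i : ℕ))⁻¹) := ((Commute.refl A).pow_pow 2 i).inv_right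
      have := this.mul_right h2
      simpa using this
    exact C.noncomm A B hA hB h3
  · exact h

theorem Cov.small {G : Type} [Group G] [Finite G] {ν : G →* A7} {z : G} (C : Cov G ν z)
    (H : Subgroup A7) (hH : ∀ p q : G, ν p ∈ H → ν q ∈ H → p * q ≠ z * (q * p)) :
    Nat.card H < 45 := by
  have : Fact (Nat.Prime 2) := ⟨by norm_num⟩
  let P : Sylow 2 H := default
  have hpT : IsPGroup 2 ((P : Subgroup H).map H.subtype) := P.isPGroup'.map _
  obtain ⟨Q, hQ⟩ := hpT.exists_le_sylow
  let D : Sylow 2 A7 := Sylow.ofCard D0 (by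
    rw [card_D0, card_A7, Nat.factorization_def _ Nat.prime_two,
      show 2520 = 2 ^ 3 * 315 by norm_num, padicValNat.mul (by norm_num) (by norm_num),
      padicValNat.prime_pow, padicValNat.eq_zero_of_not_dvd (by norm_num)]
    norm_num)
  obtain ⟨g, hg⟩ := MulAction.exists_smul_eq A7 D Q
  let φ : H →* A7 := (MulAut.conj g⁻¹).toMonoidHom.comp H.subtype
  have hφ : ∀ h : H, φ h = g⁻¹ * h * g := by intro h; simp [φ]
  have hφi : Function.Injective φ := (MulAut.conj g⁻¹).injective.comp (subtype_injective H)
  let T := (P : Subgroup H).map φ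
  have hT : T ≤ D0 := by
    rintro _ ⟨x, hx, rfl⟩
    have h1 : (x : A7) ∈ (Q : Subgroup A7) := hQ (mem_map_of_mem _ hx)
    rw [← hg, Sylow.coe_subgroup_smul, mem_pointwise_smul_iff_inv_smul_mem] at h1
    rw [hφ]
    simpa [D, MulAut.smul_def] using h1
  have hTH : ∀ t ∈ T, g * t * g⁻¹ ∈ H := by
    rintro _ ⟨x, hx, rfl⟩
    rw [hφ]
    have : g * (g⁻¹ * (x : A7) * g) * g⁻¹ = x := by group
    rw [this]; exact x.2
  have hno : ∀ i : Fin 4, ea ^ 2 ∈ T → ea ^ (i : ℕ) * eb ∈ T → False := by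
    intro i h1 h2
    obtain ⟨p, hp⟩ := C.surj (g * ea ^ 2 * g⁻¹)
    obtain ⟨q, hq⟩ := C.surj (g * (ea ^ (i : ℕ) * eb) * g⁻¹)
    exact hH p q (hp ▸ hTH _ h1) (hq ▸ hTH _ h2) (C.klein g i p q hp hq)
  have hfin : ∃ r : A7, r ^ 4 = 1 ∧ T ≤ zpowers r := by
    by_cases h : ∃ i : Fin 4, ea ^ (i : ℕ) * eb ∈ T
    · obtain ⟨i, hi⟩ := h
      refine ⟨ea ^ (i : ℕ) * eb, by
        have h := ed_refl_sq i
        rw [pow_succ, pow_succ, h, one_mul, ← pow_two, h], ?_⟩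
      intro t ht
      have h2 : ea ^ 2 ∉ T := fun h => hno i h hi
      obtain ⟨k, j, rfl⟩ := mem_D0 (hT ht)
      rcases ed_refl i k j with h | h | h | h | h | h
      · rw [h]; exact one_mem _
      · rw [h]; exact mem_zpowers _
      · exact absurd (h ▸ ht) h2
      · exact absurd (h ▸ mul_mem ht ht) h2
      · exact absurd (h ▸ mul_mem ht hi) h2
      · exact absurd (h ▸ mul_mem (mul_mem ht hi) (mul_mem ht hi)) h2
    · push Not at h
      refine ⟨ea, ea_four, ?_⟩
      intro t ht
      obtain ⟨k, j, rfl⟩ := mem_D0 (hT ht)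
      fin_cases j
      · simp
      · exact absurd (by simpa using ht) (h k)
  obtain ⟨r, hr, hTr⟩ := hfin
  have hcardT : Nat.card T = Nat.card P := card_map_of_injective hφi
  refine card_le_of_cyclic ((alternatingGroup (Fin 7)).subtype.comp H.subtype)
    ((subtype_injective _).comp (subtype_injective _)) P ?_ ?_
  · have : IsCyclic T := isCyclic_of_injective (inclusion hTr) (inclusion_injective hTr)
    exact isCyclic_of_injective ((P : Subgroup H).equivMapOfInjective φ hφi).toMonoidHom
      ((P : Subgroup H).equivMapOfInjective φ hφi).injective
  · rw [← hcardT]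
    refine (card_dvd_of_le hTr).trans ?_
    rw [Nat.card_zpowers]
    exact orderOf_dvd_of_pow_eq_one hr
end DC

namespace DC
open Module

theorem exists_eig {V : Type*} [AddCommGroup V] [Module ℂ V] [FiniteDimensional ℂ V]
    (T : End ℂ V) (E : Submodule ℂ V) (hE : E ≠ ⊥) (hT : ∀ v ∈ E, T v ∈ E) :
    ∃ v ∈ E, v ≠ 0 ∧ ∃ c : ℂ, T v = c • v := by
  have : Nontrivial E := Submodule.nontrivial_iff_ne_bot.2 hE
  obtain ⟨c, hc⟩ := Module.End.exists_eigenvalue (T.restrict hT)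
  obtain ⟨v, hv⟩ := hc.exists_hasEigenvector
  refine ⟨v, v.2, by simpa using hv.2, c, ?_⟩
  have := congrArg Subtype.val hv.apply_eq_smul
  simpa using this

theorem distinct_aux (l m : ℂ) (hl : l ^ 2 + l + 1 = 0) (hm : m = 1 ∨ m = l ∨ m = l ^ 2) :
    Function.Injective ![l + 2 * m, m ^ 2 + 2 * l, l ^ 2 + 2 * m ^ 2, m + 2 * l ^ 2] := by
  have key : ∀ p q : ℂ, p ^ 2 - p * q + q ^ 2 ≠ 0 → p + q * l ≠ 0 := by
    intro p q h h0
    apply h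
    have hp : p = - q * l := by linear_combination h0
    rw [hp]; linear_combination q ^ 2 * hl
  have h2 : l ^ 2 = -1 - l := by linear_combination hl
  have h3 : l ^ 3 = 1 := by linear_combination (l - 1) * hl
  have h4 : l ^ 4 = l := by linear_combination l * (l - 1) * hl
  have k1 := key 1 (-1) (by norm_num)
  have k2 := key 1 2 (by norm_num)
  have k3 := key 1 1 (by norm_num)
  have k4 := key 2 1 (by norm_num)
  have k5 := key 0 1 (by norm_num)
  intro i j hij
  rcases hm with rfl | rfl | rfl <;> fin_cases i <;> fin_cases j <;> first | rfl | skip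
  all_goals exfalso; simp at hij; grind

theorem eig_main {V : Type*} [AddCommGroup V] [Module ℂ V] [FiniteDimensional ℂ V]
    (S T U : End ℂ V) (hS : ∀ v, S (S (S v)) = v) (hT : ∀ v, T (T (T v)) = v)
    (hST : ∀ v, S (T v) = T (S v)) (hUS : ∀ v, U (S v) = T (U v))
    (hUT : ∀ v, S (U (T v)) = U v) (hU : ∀ v, U v = 0 → v = 0)
    (hd : finrank ℂ V < 4) : ∀ v, S v = v := by
  by_contra! hne
  obtain ⟨w, hw⟩ := hne
  let E : Submodule ℂ V := LinearMap.ker (S * S + S + 1)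
  have memE : ∀ v, v ∈ E ↔ S (S v) + S v + v = 0 := by intro v; simp [E]
  have hEb : E ≠ ⊥ := by
    intro h
    have : S w - w ∈ E := by
      rw [memE]; simp only [map_sub, hS]; abel
    rw [h, Submodule.mem_bot] at this
    exact hw (sub_eq_zero.1 this)
  obtain ⟨v0, hv0, hv0n, l, hl⟩ := exists_eig S E hEb (by
    intro v hv
    rw [memE] at hv ⊢
    rw [← map_add, ← map_add, hv, map_zero])
  have hl2 : l ^ 2 + l + 1 = 0 := by
    rw [memE, hl, map_smul, hl, smul_smul] at hv0
    have : (l ^ 2 + l + 1) • v0 = 0 := by rw [← hv0]; module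
    exact (smul_eq_zero.1 this).resolve_right hv0n
  have hFb : Module.End.eigenspace S l ≠ ⊥ := by
    intro h
    have : v0 ∈ Module.End.eigenspace S l := Module.End.mem_eigenspace_iff.2 hl
    rw [h, Submodule.mem_bot] at this
    exact hv0n this
  obtain ⟨v, hv, hvn, m, hm⟩ := exists_eig T _ hFb (by
    intro v hv
    rw [Module.End.mem_eigenspace_iff] at hv ⊢
    rw [hST, hv, map_smul])
  rw [Module.End.mem_eigenspace_iff] at hv
  have hm3 : m ^ 3 = 1 := by
    have h := hT v
    simp only [hm, map_smul, smul_smul] at h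
    have : (m ^ 3 - 1) • v = 0 := by
      rw [sub_smul, one_smul, sub_eq_zero]; refine Eq.trans ?_ h; congr 1; ring
    exact sub_eq_zero.1 ((smul_eq_zero.1 this).resolve_right hvn)
  have hl3 : l ^ 3 = 1 := by linear_combination (l - 1) * hl2
  have hmc : m = 1 ∨ m = l ∨ m = l ^ 2 := by
    have : (m - 1) * ((m - l) * (m - l ^ 2)) = 0 := by
      linear_combination hm3 + (m - m ^ 2) * hl2 + (m - 1) * hl3
    rcases mul_eq_zero.1 this with h | h
    · left; exact sub_eq_zero.1 h
    · right
      rcases mul_eq_zero.1 h with h | h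
      · left; exact sub_eq_zero.1 h
      · right; exact sub_eq_zero.1 h
  have step : ∀ (x : V) (p q : ℂ), q ^ 3 = 1 → S x = p • x → T x = q • x →
      S (U x) = q ^ 2 • U x ∧ T (U x) = p • U x := by
    intro x p q hq h1 h2
    constructor
    · have h := hUT x
      rw [h2, map_smul, map_smul] at h
      have h' := congrArg (fun y => q ^ 2 • y) h
      simp only [smul_smul] at h'
      rwa [show q ^ 2 * q = 1 by rw [← hq]; ring, one_smul] at h'
    · rw [← hUS, h1, map_smul]
  obtain ⟨a1, b1⟩ := step v l m hm3 hv hm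
  obtain ⟨a2, b2⟩ := step (U v) _ _ hl3 a1 b1
  obtain ⟨a3, b3⟩ := step (U (U v)) _ _ (by rw [← pow_mul, mul_comm, pow_mul, hm3, one_pow]) a2 b2
  have hm4 : (m ^ 2) ^ 2 = m := by linear_combination m * hm3
  rw [hm4] at a3
  have hli := Module.End.eigenvectors_linearIndependent' (S + (2 : ℂ) • T)
    ![l + 2 * m, m ^ 2 + 2 * l, l ^ 2 + 2 * m ^ 2, m + 2 * l ^ 2] (distinct_aux l m hl2 hmc)
    ![v, U v, U (U v), U (U (U v))] (by
      have n1 : U v ≠ 0 := fun h => hvn (hU _ h)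
      have n2 : U (U v) ≠ 0 := fun h => n1 (hU _ h)
      have n3 : U (U (U v)) ≠ 0 := fun h => n2 (hU _ h)
      intro i
      refine ⟨Module.End.mem_eigenspace_iff.2 ?_, ?_⟩
      · fin_cases i
        · simp [hv, hm]; module
        · simp [a1, b1]; module
        · simp [a2, b2]; module
        · simp [a3, b3]; module
      · fin_cases i
        · simpa using hvn
        · simpa using n1
        · simpa using n2
        · simpa using n3)
  have := hli.fintype_card_le_finrank
  simp at this
  omega

def es : A7 := ⟨Equiv.swap 0 1 * Equiv.swap 1 2, by
  rw [Equiv.Perm.mem_alternatingGroup]; decide +kernel⟩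
def et : A7 := ⟨Equiv.swap 3 4 * Equiv.swap 4 5, by
  rw [Equiv.Perm.mem_alternatingGroup]; decide +kernel⟩
def eu : A7 := ⟨Equiv.swap 0 3 * Equiv.swap 3 1 * Equiv.swap 1 4 * Equiv.swap 2 5, by
  rw [Equiv.Perm.mem_alternatingGroup]; decide +kernel⟩
def ek : A7 := ⟨Equiv.swap 2 3 * Equiv.swap 3 4, by
  rw [Equiv.Perm.mem_alternatingGroup]; decide +kernel⟩
def em : A7 := ⟨Equiv.swap 1 3 * Equiv.swap 3 4, by
  rw [Equiv.Perm.mem_alternatingGroup]; decide +kernel⟩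
def er : A7 := ⟨finRotate 7, by
  rw [Equiv.Perm.mem_alternatingGroup]; decide +kernel⟩

theorem es_cube : es ^ 3 = 1 := by decide +kernel
theorem eus : eu * es * eu⁻¹ = et := by decide +kernel
theorem eut : eu * et * eu⁻¹ = es⁻¹ := by decide +kernel
theorem est : et * es * et⁻¹ = es := by decide +kernel
theorem ex_eq : es * (ek * es * ek⁻¹) = ea ^ 2 := by decide +kernel
theorem ey_eq : es * (em * es * em⁻¹) = ea ^ ((1 : Fin 4) : ℕ) * eb := by decide +kernel
theorem efix : (es : Equiv.Perm (Fin 7)) 6 = 6 ∧ (et : Equiv.Perm (Fin 7)) 6 = 6 ∧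
    (eu : Equiv.Perm (Fin 7)) 6 = 6 ∧ (ek : Equiv.Perm (Fin 7)) 6 = 6 ∧
    (em : Equiv.Perm (Fin 7)) 6 = 6 := by decide +kernel
theorem erot : ∀ a : Fin 7, ((er ^ ((a : ℕ) + 1) : A7) : Equiv.Perm (Fin 7)) 6 = a := by
  decide +kernel

theorem Cov.uniq3 {G : Type} [Group G] {ν : G →* A7} {z : G} (C : Cov G ν z)
    {g h : G} (e : ν g = ν h) (hg : g ^ 3 = 1) (hh : h ^ 3 = 1) : g = h := by
  rcases C.lift e with h1 | h1
  · exact h1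
  · exfalso
    have : (z * h) ^ 3 = z := by
      rw [(show Commute z h from C.cen h).mul_pow, hh, mul_one, pow_succ, pow_two, C.sq, one_mul]
    rw [h1, this] at hg
    exact C.ne hg

theorem Cov.irr {G : Type} [Group G] [Finite G] {ν : G →* A7} {z : G} (C : Cov G ν z)
    {V : Type} [AddCommGroup V] [Module ℂ V] [FiniteDimensional ℂ V] (ρ : Representation ℂ G V)
    (hz : ∀ v, ρ z v = -v) (a : Fin 7) (W : Submodule ℂ V)
    (hW : ∀ g : G, (ν g : Equiv.Perm (Fin 7)) a = a → ∀ v ∈ W, ρ g v ∈ W)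
    (hd : finrank ℂ W < 4) : W = ⊥ := by
  obtain ⟨σ, hσ⟩ : ∃ σ : A7, (σ : Equiv.Perm (Fin 7)) 6 = a := ⟨_, erot a⟩
  have hst : ∀ k : A7, (k : Equiv.Perm (Fin 7)) 6 = 6 →
      ((σ * k * σ⁻¹ : A7) : Equiv.Perm (Fin 7)) a = a := by
    intro k hk
    have : (Equiv.symm (σ : Equiv.Perm (Fin 7))) a = 6 := by rw [← hσ]; simp
    simp [this, hk, hσ]
  obtain ⟨f1, f2, f3, f4, f5⟩ := efix
  obtain ⟨s, hs, hs3⟩ : ∃ s : G, ν s = σ * es * σ⁻¹ ∧ s ^ 3 = 1 := by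
    obtain ⟨s, hs⟩ := C.surj (σ * es * σ⁻¹)
    have h3 : ν (s ^ 3) = 1 := by
      rw [map_pow, hs, conj_pow, es_cube]; simp
    rcases C.ker _ h3 with h | h
    · exact ⟨s, hs, h⟩
    · refine ⟨z * s, by rw [map_mul, C.nz, one_mul, hs], ?_⟩
      rw [(show Commute z s from C.cen s).mul_pow, h, pow_succ, pow_two, C.sq, one_mul, C.sq]
  obtain ⟨u, hu⟩ := C.surj (σ * eu * σ⁻¹)
  obtain ⟨t, ht⟩ : ∃ t, t = u * s * u⁻¹ := ⟨_, rfl⟩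
  have hνt : ν t = σ * et * σ⁻¹ := by
    rw [ht, map_mul, map_mul, map_inv, hu, hs, ← eus]; group
  have ht3 : t ^ 3 = 1 := by rw [ht, conj_pow, hs3]; simp
  have hut : u * t * u⁻¹ = s⁻¹ := by
    refine C.uniq3 ?_ (by rw [conj_pow, ht3]; simp) (by rw [inv_pow, hs3, inv_one])
    rw [map_mul, map_mul, map_inv, map_inv, hu, hνt, hs]
    calc _ = σ * (eu * et * eu⁻¹) * σ⁻¹ := by group
      _ = _ := by rw [eut]; group
  have hts : t * s * t⁻¹ = s := by
    refine C.uniq3 ?_ (by rw [conj_pow, hs3]; simp) hs3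
    rw [map_mul, map_mul, map_inv, hνt, hs]
    calc _ = σ * (et * es * et⁻¹) * σ⁻¹ := by group
      _ = _ := by rw [est]
  have Ws := hW s (by rw [hs]; exact hst _ f1)
  have Wt := hW t (by rw [hνt]; exact hst _ f2)
  have Wu := hW u (by rw [hu]; exact hst _ f3)
  have rm : ∀ (g h : G) (v : V), ρ g (ρ h v) = ρ (g * h) v := by intro g h v; rw [map_mul]; rfl
  have hsW : ∀ v ∈ W, ρ s v = v := by
    have := eig_main ((ρ s).restrict Ws) ((ρ t).restrict Wt) ((ρ u).restrict Wu)
      (by intro v; ext; simp only [LinearMap.coe_restrict_apply, rm]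
          rw [show s * (s * s) = s ^ 3 by rw [pow_succ, pow_two, mul_assoc], hs3]; simp)
      (by intro v; ext; simp only [LinearMap.coe_restrict_apply, rm]
          rw [show t * (t * t) = t ^ 3 by rw [pow_succ, pow_two, mul_assoc], ht3]; simp)
      (by intro v; ext; simp only [LinearMap.coe_restrict_apply, rm]
          rw [← mul_inv_eq_iff_eq_mul.1 hts])
      (by intro v; ext; simp only [LinearMap.coe_restrict_apply, rm]
          rw [ht]; simp)
      (by intro v; ext; simp only [LinearMap.coe_restrict_apply, rm]
          rw [mul_inv_eq_iff_eq_mul.1 hut]; simp)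
      (by
        intro v hv
        have h1 : ρ u (v : V) = 0 := by
          simpa using congrArg Subtype.val hv
        have h2 := rm u⁻¹ u (v : V)
        rw [h1] at h2
        ext
        simpa using h2.symm)
      hd
    intro v hv
    simpa using congrArg Subtype.val (this ⟨v, hv⟩)
  have hprod : ∀ k : A7, (k : Equiv.Perm (Fin 7)) 6 = 6 → ∃ p : G,
      ν p = σ * (es * (k * es * k⁻¹)) * σ⁻¹ ∧ ∀ v ∈ W, ρ p v = v := by
    intro k hk
    obtain ⟨κ, hκ⟩ := C.surj (σ * k * σ⁻¹)
    refine ⟨s * (κ * s * κ⁻¹), ?_, ?_⟩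
    · simp only [map_mul, map_inv, hκ, hs]; group
    · intro v hv
      have h1 : ρ κ⁻¹ v ∈ W := by
        refine hW _ ?_ v hv
        have h6 : (k : Equiv.Perm (Fin 7))⁻¹ 6 = 6 := by
          rw [Equiv.Perm.inv_eq_iff_eq, hk]
        have := hst k⁻¹ h6
        rw [map_inv, hκ]
        simpa [mul_assoc] using this
      simp only [← rm]
      rw [hsW _ h1, rm]
      simpa using hsW v hv
  obtain ⟨p, hp, hpW⟩ := hprod ek f4
  obtain ⟨q, hq, hqW⟩ := hprod em f5
  rw [ex_eq] at hp
  rw [ey_eq] at hq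
  have hpq := C.klein σ 1 p q hp hq
  rw [Submodule.eq_bot_iff]
  intro v hv
  have h1 : ρ (p * q) v = v := by rw [← rm, hqW v hv, hpW v hv]
  have h2 : ρ (q * p) v = v := by rw [← rm, hpW v hv, hqW v hv]
  rw [hpq, ← rm, h2, hz] at h1
  have h3 : (2 : ℂ) • v = 0 := by
    rw [two_smul]; nth_rewrite 1 [← h1]; simp
  exact (smul_eq_zero.1 h3).resolve_left two_ne_zero

theorem Cov.line {G : Type} [Group G] [Finite G] {ν : G →* A7} {z : G} (C : Cov G ν z)
    {V : Type} [AddCommGroup V] [Module ℂ V] [FiniteDimensional ℂ V] (ρ : Representation ℂ G V)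
    (hz : ∀ v, ρ z v = -v) (H : Subgroup A7) (hi : H.index ≤ 56) (W : Submodule ℂ V)
    (hW : ∀ g : G, ν g ∈ H → ∀ v ∈ W, ρ g v ∈ W) : finrank ℂ W ≠ 1 := by
  intro h1
  have rm : ∀ (g h : G) (v : V), ρ g (ρ h v) = ρ (g * h) v := by intro g h v; rw [map_mul]; rfl
  have hcard : Nat.card H < 45 := by
    refine C.small H ?_
    intro p q hp hq hpq
    obtain ⟨w, hw0, hw⟩ := finrank_eq_one_iff'.1 h1
    have hw0' : (w : V) ≠ 0 := by simpa using hw0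
    have hsc : ∀ g : G, ν g ∈ H → ∃ c : ℂ, ρ g (w : V) = c • (w : V) ∧ c ≠ 0 := by
      intro g hg
      obtain ⟨c, hc⟩ := hw ⟨ρ g w, hW g hg w w.2⟩
      have hc' : c • (w : V) = ρ g w := congrArg Subtype.val hc
      refine ⟨c, hc'.symm, ?_⟩
      rintro rfl
      have h2 := rm g⁻¹ g (w : V)
      rw [← hc'] at h2
      simp at h2
      exact hw0' h2.symm
    obtain ⟨c, hc, hc0⟩ := hsc p hp
    obtain ⟨d, hd, hd0⟩ := hsc q hq
    have e := congrArg (fun g => ρ g (w : V)) hpq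
    simp only [← rm, hc, hd, map_smul, hz, smul_smul] at e
    have : (2 * (c * d)) • (w : V) = 0 := by
      rw [two_mul, add_smul, mul_comm c d]
      nth_rewrite 1 [e]
      rw [mul_comm]; simp
    rcases smul_eq_zero.1 this with h | h
    · simp [hc0, hd0] at h
    · exact hw0' h
  have := H.card_mul_index
  rw [card_A7] at this
  nlinarith

theorem Cov.orbit {G : Type} [Group G] [Finite G] {ν : G →* A7} {z : G} (C : Cov G ν z)
    {V : Type} [AddCommGroup V] [Module ℂ V] [FiniteDimensional ℂ V] (ρ : Representation ℂ G V)
    (hz : ∀ v, ρ z v = -v) (v : V) (hv : v ≠ 0) :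
    56 < Set.ncard {L : Submodule ℂ V | ∃ g : G, L = Submodule.span ℂ {ρ g v}} := by
  let act : MulAction G (Submodule ℂ V) :=
    { smul := fun g L => L.map (ρ g)
      one_smul := by intro L; change L.map (ρ 1) = L; rw [map_one]; exact Submodule.map_id L
      mul_smul := by
        intro g h L
        change L.map (ρ (g * h)) = (L.map (ρ h)).map (ρ g)
        rw [map_mul]; exact Submodule.map_comp _ _ _ }
  have hs : ∀ (g : G) (L : Submodule ℂ V), g • L = L.map (ρ g) := fun _ _ => rfl
  have hsv : ∀ g : G, g • (Submodule.span ℂ {v}) = Submodule.span ℂ {ρ g v} := by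
    intro g; rw [hs, Submodule.map_span, Set.image_singleton]
  have horb : {L : Submodule ℂ V | ∃ g : G, L = Submodule.span ℂ {ρ g v}} =
      MulAction.orbit G (Submodule.span ℂ {v}) := by
    ext L
    simp only [Set.mem_ofPred_eq, MulAction.mem_orbit_iff, hsv]
    exact ⟨fun ⟨g, h⟩ => ⟨g, h.symm⟩, fun ⟨g, h⟩ => ⟨g, h.symm⟩⟩
  rw [horb, ← MulAction.index_stabilizer]
  by_contra! hle
  set K := MulAction.stabilizer G (Submodule.span ℂ {v}) with hK
  have hzK : z ∈ K := by
    rw [hK, MulAction.mem_stabilizer_iff, hsv, hz, ← Set.neg_singleton, Submodule.span_neg]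
  have hcm : (K.map ν).comap ν = K := by
    refine le_antisymm ?_ (Subgroup.le_comap_map _ _)
    rintro g ⟨k, hk, e⟩
    rcases C.lift e.symm with h | h <;> rw [h]
    · exact hk
    · exact mul_mem hzK hk
  have hi : (K.map ν).index ≤ 56 := by
    rw [← Subgroup.index_comap_of_surjective _ C.surj, hcm]; exact hle
  refine C.line ρ hz (K.map ν) hi (Submodule.span ℂ {v}) ?_ (finrank_span_singleton hv)
  intro g hg w hw
  have : g ∈ K := by rw [← hcm]; exact hg
  rw [hK, MulAction.mem_stabilizer_iff, hs] at this
  rw [← this]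
  exact Submodule.mem_map_of_mem hw

end DC

/-- Let `V` be a faithful irreducible four-dimensional complex representation of `2.A₇`, with
quotient map `ν : 2.A₇ → A₇`.  For every proper subgroup `H ⊆ A₇` of index at most `42`, the
restriction of `V` to the preimage `ν⁻¹(H)` contains no one-dimensional subrepresentation.
In particular, the restriction of `V` to a subgroup `2.A₆ = ν⁻¹(A₆)` (the preimage of a point
stabiliser) is irreducible, and the induced action of `A₇` on `ℙ³ = ℙ(V)` has no orbit of size
at most `56`. -/
theorem doubleCoverA7_restrictions_no_one_dim
    (G : Type) [Group G] [Finite G] (hG : IsDoubleCoverA7 G)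
    (ν : G →* alternatingGroup (Fin 7))
    (hsurj : Function.Surjective ν) (hker : ν.ker = Subgroup.center G)
    (V : Type) [AddCommGroup V] [Module ℂ V] [FiniteDimensional ℂ V]
    (ρ : Representation ℂ G V)
    (hfaithful : Function.Injective ρ)
    (hdim : Module.finrank ℂ V = 4)
    (hirr : ∀ W : Submodule ℂ V, (∀ g : G, ∀ v ∈ W, ρ g v ∈ W) → W = ⊥ ∨ W = ⊤) :
    (∀ H : Subgroup (alternatingGroup (Fin 7)), H ≠ ⊤ → H.index ≤ 42 →
      ∀ W : Submodule ℂ V,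
        (∀ g ∈ Subgroup.comap ν H, ∀ v ∈ W, ρ g v ∈ W) →
        Module.finrank ℂ W ≠ 1) ∧
    (∀ a : Fin 7, ∀ W : Submodule ℂ V,
      (∀ g ∈ Subgroup.comap (((alternatingGroup (Fin 7)).subtype).comp ν)
          (MulAction.stabilizer (Equiv.Perm (Fin 7)) a),
        ∀ v ∈ W, ρ g v ∈ W) →
      W = ⊥ ∨ W = ⊤) ∧
    (∀ v : V, v ≠ 0 →
      56 < Set.ncard {L : Submodule ℂ V | ∃ g : G, L = Submodule.span ℂ {ρ g v}}) := by
  obtain ⟨hperf, -, hcard, -⟩ := hG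
  obtain ⟨z, hz1, hzu⟩ := (Nat.card_eq_two_iff' (1 : Subgroup.center G)).1 hcard
  have hzu' : ∀ y ∈ Subgroup.center G, y ≠ 1 → y = z := by
    intro y hy hy1
    have := hzu ⟨y, hy⟩ (fun h => hy1 (congrArg Subtype.val h))
    exact congrArg Subtype.val this
  have hcen : ∀ g, (z : G) * g = g * z := fun g => (Subgroup.mem_center_iff.1 z.2 g).symm
  have hzne : (z : G) ≠ 1 := fun h => hz1 (Subtype.ext h)
  have C : DC.Cov G ν (z : G) :=
    { surj := hsurj
      perf := hperf
      ker := by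
        intro g hg
        have : g ∈ Subgroup.center G := by rw [← hker]; exact hg
        by_cases h : g = 1
        · exact Or.inl h
        · exact Or.inr (hzu' g this h)
      nz := by
        have h : (z : G) ∈ ν.ker := by rw [hker]; exact z.2
        exact h
      cen := hcen
      sq := by
        by_contra h
        have := hzu' _ (mul_mem z.2 z.2) h
        exact hzne (mul_eq_left.1 this)
      ne := hzne }
  have rm : ∀ (g h : G) (v : V), ρ g (ρ h v) = ρ (g * h) v := by intro g h v; rw [map_mul]; rfl
  have hz : ∀ v, ρ z v = -v := by
    let W : Submodule ℂ V := LinearMap.eqLocus (ρ z) LinearMap.id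
    have memW : ∀ v, v ∈ W ↔ ρ z v = v := fun v => Iff.rfl
    rcases hirr W (by
      intro g v hv
      rw [memW] at hv ⊢
      rw [rm, hcen, ← rm, hv]) with h | h
    · intro v
      have : ρ z v + v ∈ W := by
        rw [memW, map_add, rm, C.sq, map_one, Module.End.one_apply, add_comm]
      rw [h, Submodule.mem_bot] at this
      exact eq_neg_of_add_eq_zero_left this
    · exfalso
      apply hzne
      apply hfaithful
      ext v
      have : v ∈ W := by rw [h]; exact Submodule.mem_top
      rw [map_one]; exact this
  refine ⟨?_, ?_, ?_⟩
  · intro H _ hi W hW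
    exact C.line ρ hz H (by omega) W hW
  · intro a W hW
    by_cases hd : Module.finrank ℂ W < 4
    · left
      exact C.irr ρ hz a W (fun g hg => hW g hg) hd
    · right
      apply Submodule.eq_top_of_finrank_eq
      have := Submodule.finrank_le W
      omega
  · exact fun v hv => C.orbit ρ hz v hv
end
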